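/- arXiv:math/0701384 — 2 statements merged into one kernel-verified Lean document; each statement's English description precedes it below -/
import Mathlib

section
/- Let Γ be a finitely generated group, Γ₀ a normal subgroup of Γ, and ρ₁, ρ₂ : Γ → PSL(2,ℂ) homomorphisms whose restrictions to Γ₀ are equal and irreducible; write ρ₀ for this common restriction. Then one of the following holds: (a) ρ₁ = ρ₂; (b) there exist B ∈ PSL(2,ℂ) and a homomorphism φ : Γ → Z(𝒩) that is trivial on Γ₀ such that B ρⱼ(Γ) B⁻¹ ⊆ 𝒩 for j = 1, 2 and B ρ₂(γ) B⁻¹ = φ(γ) · (B ρ₁(γ) B⁻¹) for all γ ∈ Γ; (c) ρ₀(Γ₀) is isomorphic to the Klein four-group ℤ/2 × ℤ/2, and ρ₁(Γ) = ρ₂(Γ) is isomorphic to one of: the Klein four-group, the dihedral group of order 8, the alternating group A₄, or the symmetric group S₄. Moreover, there are only finitely many PSL(2,ℂ)-conjugacy classes of homomorphisms Γ → PSL(2,ℂ) whose image is isomorphic to one of these four groups. -/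
noncomputable section

/-- `SL(2,ℂ)`. -/
abbrev SL2C : Type := Matrix.SpecialLinearGroup (Fin 2) ℂ

/-- `PSL(2,ℂ)`, the quotient of `SL(2,ℂ)` by its center `{±I}`. -/
abbrev PSL2C : Type := SL2C ⧸ Subgroup.center SL2C

/-- The canonical projection `SL(2,ℂ) → PSL(2,ℂ)`. -/
def projPSL : SL2C →* PSL2C := QuotientGroup.mk' (Subgroup.center SL2C)

/-- A homomorphism into `PSL(2,ℂ)` is reducible if some nonzero `v ∈ ℂ²` is an eigenvector of
every matrix representing an element of the image. -/
def IsReducibleRep {Γ : Type*} [Group Γ] (ρ : Γ →* PSL2C) : Prop :=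
  ∃ v : Fin 2 → ℂ, v ≠ 0 ∧ ∀ (γ : Γ) (M : SL2C), projPSL M = ρ γ →
    ∃ c : ℂ, Matrix.mulVec (M : Matrix (Fin 2) (Fin 2) ℂ) v = c • v

/-- The subgroup `𝒩 ⊆ PSL(2,ℂ)` of classes of matrices that are either diagonal or have both
diagonal entries `0`, as a set. -/
def NNset : Set PSL2C :=
  {x | ∃ M : SL2C, projPSL M = x ∧
    (((M : Matrix (Fin 2) (Fin 2) ℂ) 0 1 = 0 ∧ (M : Matrix (Fin 2) (Fin 2) ℂ) 1 0 = 0) ∨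
     ((M : Matrix (Fin 2) (Fin 2) ℂ) 0 0 = 0 ∧ (M : Matrix (Fin 2) (Fin 2) ℂ) 1 1 = 0))}

/-- The matrix `diag(i, -i)` as an element of `SL(2,ℂ)`; its class generates the center of `𝒩`
together with `1`. -/
def DiagI : SL2C :=
  ⟨!![Complex.I, 0; 0, -Complex.I], by norm_num [Matrix.det_fin_two_of, Complex.I_mul_I]⟩

/-- The image of a homomorphism into `PSL(2,ℂ)` is isomorphic to one of: the Klein four-group,
the dihedral group of order 8, the alternating group `A₄`, the symmetric group `S₄`. -/
def HasSmallDihedralTypeImage {Γ : Type*} [Group Γ] (ρ : Γ →* PSL2C) : Prop :=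
  IsKleinFour ↥ρ.range ∨ Nonempty (↥ρ.range ≃* DihedralGroup 4) ∨
    Nonempty (↥ρ.range ≃* alternatingGroup (Fin 4)) ∨ Nonempty (↥ρ.range ≃* Equiv.Perm (Fin 4))


set_option linter.unusedSimpArgs false

/-! ### Basic facts -/

def JJ : SL2C := ⟨!![0, 1; -1, 0], by norm_num [Matrix.det_fin_two_of]⟩

theorem D00 : DiagI.1 0 0 = Complex.I := rfl
theorem D01 : DiagI.1 0 1 = 0 := rfl
theorem D10 : DiagI.1 1 0 = 0 := rfl
theorem D11 : DiagI.1 1 1 = -Complex.I := rfl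
theorem J00 : JJ.1 0 0 = 0 := rfl
theorem J01 : JJ.1 0 1 = 1 := rfl
theorem J10 : JJ.1 1 0 = -1 := rfl
theorem J11 : JJ.1 1 1 = 0 := rfl
theorem slm (M N : SL2C) (i j : Fin 2) : (M * N).1 i j = M.1 i 0 * N.1 0 j + M.1 i 1 * N.1 1 j := by
  change (M.1 * N.1) i j = _
  rw [Matrix.mul_apply, Fin.sum_univ_two]
theorem sln (M : SL2C) (i j : Fin 2) : (-M).1 i j = - M.1 i j := by
  rw [← Matrix.neg_apply]; rfl
theorem slo (i j : Fin 2) : (1 : SL2C).1 i j = if i = j then 1 else 0 := by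
  change (1 : Matrix (Fin 2) (Fin 2) ℂ) i j = _
  rw [Matrix.one_apply]

theorem projPSL_surj (x : PSL2C) : ∃ M : SL2C, projPSL M = x :=
  QuotientGroup.mk'_surjective _ x

theorem projPSL_eq_one (M : SL2C) : projPSL M = 1 ↔ M = 1 ∨ M = -1 := by
  unfold projPSL
  rw [QuotientGroup.mk'_apply, QuotientGroup.eq_one_iff, Matrix.SpecialLinearGroup.mem_center_iff]
  constructor
  · rintro ⟨r, hr, h⟩
    simp only [Fintype.card_fin] at hr
    rcases (by simpa using hr : r = 1 ∨ r = -1) with h1 | h1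
    · left; ext i j; rw [← h, h1]; simp
    · right; ext i j; rw [← h, h1]; fin_cases i <;> fin_cases j <;> simp
  · rintro (h | h)
    · exact ⟨1, by simp, by rw [h]; simp⟩
    · exact ⟨-1, by simp, by
        rw [h]; ext i j; fin_cases i <;> fin_cases j <;> simp⟩

theorem projPSL_eq (M N : SL2C) : projPSL M = projPSL N ↔ M = N ∨ M = -N := by
  rw [← mul_inv_eq_one, ← map_inv, ← map_mul, projPSL_eq_one, mul_inv_eq_one, mul_inv_eq_iff_eq_mul]
  simp

theorem projPSL_neg (M : SL2C) : projPSL (-M) = projPSL M := (projPSL_eq _ _).2 (Or.inr rfl)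

theorem sl_ext_iff (M N : SL2C) : M = N ↔ M.1 0 0 = N.1 0 0 ∧ M.1 0 1 = N.1 0 1 ∧
    M.1 1 0 = N.1 1 0 ∧ M.1 1 1 = N.1 1 1 := by
  constructor
  · rintro rfl; simp
  · rintro ⟨a, b, c, d⟩
    ext i j; fin_cases i <;> fin_cases j <;> assumption

theorem sl_det (M : SL2C) : M.1 0 0 * M.1 1 1 - M.1 0 1 * M.1 1 0 = 1 := by
  have := M.2; rwa [Matrix.det_fin_two] at this

theorem comm_iff (M N : SL2C) : projPSL M * projPSL N = projPSL N * projPSL M ↔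
    M * N = N * M ∨ M * N = -(N * M) := by
  rw [← map_mul, ← map_mul, projPSL_eq]

/-- anticommuting elements square to -1 -/
theorem anti_sq {Z W : SL2C} (h : Z * W = -(W * Z)) : Z * Z = -1 := by
  have h1 := sl_det Z
  have h2 := sl_det W
  have ht : Z.1 0 0 + Z.1 1 1 = 0 := by
    have : Z = -(W * Z * W⁻¹) := by rw [← neg_mul, ← h]; simp
    have h3 : Z.1.trace = -(Z.1).trace := by
      conv_lhs => rw [this]
      rw [Matrix.SpecialLinearGroup.coe_neg, Matrix.trace_neg, Matrix.SpecialLinearGroup.coe_mul,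
        Matrix.trace_mul_comm, ← Matrix.SpecialLinearGroup.coe_mul, ← mul_assoc, inv_mul_cancel,
        one_mul]
    rw [Matrix.trace_fin_two] at h3
    linear_combination h3 / 2
  rw [sl_ext_iff]
  simp only [Matrix.SpecialLinearGroup.coe_mul, Matrix.SpecialLinearGroup.coe_neg, Matrix.mul_apply,
    Fin.sum_univ_two, Matrix.neg_apply, Matrix.SpecialLinearGroup.coe_one]
  simp
  refine ⟨?_, ?_, ?_, ?_⟩
  · linear_combination Z.1 0 0 * ht - h1
  · linear_combination Z.1 0 1 * ht
  · linear_combination Z.1 1 0 * ht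
  · linear_combination Z.1 1 1 * ht - h1

theorem anti_sq' {Z W : SL2C} (h : Z * W = -(W * Z)) : W * W = -1 := by
  apply anti_sq (W := Z); rw [h]; simp

theorem exists_eigen (Z : Matrix (Fin 2) (Fin 2) ℂ) :
    ∃ (c : ℂ) (v : Fin 2 → ℂ), v ≠ 0 ∧ Z.mulVec v = c • v := by
  obtain ⟨c, hc⟩ := Module.End.exists_eigenvalue (Matrix.toLin' Z)
  obtain ⟨v, hv⟩ := hc.exists_hasEigenvector
  exact ⟨c, v, hv.2, by simpa using hv.apply_eq_smul⟩

theorem conj_pair {Z W : SL2C} (h : Z * W = -(W * Z)) :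
    ∃ P : SL2C, Z * P = P * DiagI ∧ W * P = P * JJ := by
  have hZ := anti_sq h
  have hW := anti_sq' h
  have hI : Complex.I * Complex.I = -1 := Complex.I_mul_I
  -- eigenvector for I
  obtain ⟨a, b, hab, e1, e2⟩ : ∃ a b : ℂ, (a ≠ 0 ∨ b ≠ 0) ∧
      Z.1 0 0 * a + Z.1 0 1 * b = Complex.I * a ∧ Z.1 1 0 * a + Z.1 1 1 * b = Complex.I * b := by
    obtain ⟨c, v, hv, he⟩ := exists_eigen Z.1
    have hv' : v 0 ≠ 0 ∨ v 1 ≠ 0 := by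
      by_contra hc; push Not at hc; apply hv; ext i; fin_cases i <;> simp [hc]
    have f1 := congrFun he 0
    have f2 := congrFun he 1
    simp only [Matrix.mulVec, dotProduct, Fin.sum_univ_two, Pi.smul_apply, smul_eq_mul] at f1 f2
    have hc : c * c = -1 := by
      have g1 := congrArg (fun M : SL2C => M.1.mulVec v) hZ
      simp only [Matrix.SpecialLinearGroup.coe_mul, ← Matrix.mulVec_mulVec, he,
        Matrix.mulVec_smul] at g1
      rcases hv' with h0 | h0
      · have := congrFun g1 0
        simp [Matrix.mulVec, dotProduct, Fin.sum_univ_two] at this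
        apply mul_right_cancel₀ h0; linear_combination this
      · have := congrFun g1 1
        simp [Matrix.mulVec, dotProduct, Fin.sum_univ_two] at this
        apply mul_right_cancel₀ h0; linear_combination this
    have hc' : c = Complex.I ∨ c = -Complex.I := by
      have : (c - Complex.I) * (c + Complex.I) = 0 := by linear_combination hc - hI
      rcases mul_eq_zero.1 this with h | h
      · left; linear_combination h
      · right; linear_combination h
    rcases hc' with rfl | rfl
    · exact ⟨v 0, v 1, hv', f1, f2⟩
    · -- use W v
      have g1 := congrArg (fun M : SL2C => M.1.mulVec v) h
      have g2 := congrArg (fun M : SL2C => M.1.mulVec v) hW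
      simp only [Matrix.SpecialLinearGroup.coe_mul, Matrix.SpecialLinearGroup.coe_neg,
        Matrix.neg_mulVec, ← Matrix.mulVec_mulVec, he, Matrix.mulVec_smul] at g1 g2
      refine ⟨W.1.mulVec v 0, W.1.mulVec v 1, ?_, ?_, ?_⟩
      · by_contra hc; push Not at hc
        have : W.1.mulVec v = 0 := by ext i; fin_cases i <;> simp [hc]
        rw [this] at g2
        apply hv
        simpa using g2.symm
      · have := congrFun g1 0
        rw [Matrix.mulVec] at this
        simpa [dotProduct, Fin.sum_univ_two] using this
      · have := congrFun g1 1
        rw [Matrix.mulVec] at this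
        simpa [dotProduct, Fin.sum_univ_two] using this
  rw [sl_ext_iff] at h hZ hW
  simp only [Matrix.SpecialLinearGroup.coe_mul, Matrix.SpecialLinearGroup.coe_neg, Matrix.mul_apply,
    Fin.sum_univ_two, Matrix.neg_apply, Matrix.SpecialLinearGroup.coe_one] at h hZ hW
  simp at hZ hW
  obtain ⟨h1, h2, h3, h4⟩ := h
  obtain ⟨w1, w2, w3, w4⟩ := hW
  set c := -(W.1 0 0 * a + W.1 0 1 * b) with hc
  set d := -(W.1 1 0 * a + W.1 1 1 * b) with hd
  have k1 : Z.1 0 0 * c + Z.1 0 1 * d = -Complex.I * c := by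
    rw [hc, hd]
    linear_combination (-a) * h1 - b * h2 + W.1 0 0 * e1 + W.1 0 1 * e2
  have k2 : Z.1 1 0 * c + Z.1 1 1 * d = -Complex.I * d := by
    rw [hc, hd]
    linear_combination (-a) * h3 - b * h4 + W.1 1 0 * e1 + W.1 1 1 * e2
  have m1 : W.1 0 0 * c + W.1 0 1 * d = a := by
    rw [hc, hd]; linear_combination (-a) * w1 - b * w2
  have m2 : W.1 1 0 * c + W.1 1 1 * d = b := by
    rw [hc, hd]; linear_combination (-a) * w3 - b * w4
  have hdet : a * d - b * c ≠ 0 := by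
    intro h0
    -- (c,d) is proportional to (a,b)
    have hI0 : Complex.I ≠ 0 := Complex.I_ne_zero
    have hcd : c = 0 ∧ d = 0 := by
      rcases hab with ha | hb
      · have hc0 : c = 0 := by
          have : 2 * Complex.I * a * c = 0 := by
            linear_combination (-c) * e1 + a * k1 - Z.1 0 1 * h0
          simpa [ha, hI0] using this
        refine ⟨hc0, ?_⟩
        rw [hc0] at h0
        simpa [ha] using h0
      · have hd0 : d = 0 := by
          have : 2 * Complex.I * b * d = 0 := by
            linear_combination (-d) * e2 + b * k2 + Z.1 1 0 * h0
          simpa [hb, hI0] using this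
        refine ⟨?_, hd0⟩
        rw [hd0] at h0
        simpa [hb] using h0
    rw [hcd.1, hcd.2] at m1 m2
    simp at m1 m2
    rcases hab with ha | hb
    · exact ha m1.symm
    · exact hb m2.symm
  obtain ⟨s, hs⟩ := IsAlgClosed.exists_pow_nat_eq (a * d - b * c)⁻¹ (n := 2) (by norm_num)
  obtain ⟨P, p1, p2, p3, p4⟩ : ∃ P : SL2C, P.1 0 0 = s * a ∧ P.1 0 1 = s * c ∧ P.1 1 0 = s * b ∧
      P.1 1 1 = s * d := by
    refine ⟨⟨!![s * a, s * c; s * b, s * d], ?_⟩, rfl, rfl, rfl, rfl⟩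
    rw [Matrix.det_fin_two_of]
    have : s * a * (s * d) - s * c * (s * b) = s ^ 2 * (a * d - b * c) := by ring
    rw [this, hs, inv_mul_cancel₀ hdet]
  refine ⟨P, ?_, ?_⟩
  · rw [sl_ext_iff]
    simp only [slm, D00, D01, D10, D11, p1, p2, p3, p4]
    refine ⟨?_, ?_, ?_, ?_⟩
    · linear_combination s * e1
    · linear_combination s * k1
    · linear_combination s * e2
    · linear_combination s * k2
  · rw [sl_ext_iff]
    simp only [slm, J00, J01, J10, J11, p1, p2, p3, p4]
    refine ⟨?_, ?_, ?_, ?_⟩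
    · rw [hc]; ring
    · linear_combination s * m1
    · rw [hd]; ring
    · linear_combination s * m2

def V0 : Subgroup PSL2C := Subgroup.centralizer {projPSL DiagI, projPSL JJ}

theorem mem_V0_iff (M : SL2C) : projPSL M ∈ V0 ↔ (M * DiagI = DiagI * M ∨ M * DiagI = -(DiagI * M)) ∧
    (M * JJ = JJ * M ∨ M * JJ = -(JJ * M)) := by
  unfold V0
  rw [Subgroup.mem_centralizer_iff, ← comm_iff, ← comm_iff]
  simp [eq_comm]

theorem DD : DiagI * DiagI = -1 := by
  have hI : Complex.I * Complex.I = -1 := Complex.I_mul_I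
  rw [sl_ext_iff]; simp [slm, sln, slo, D00, D01, D10, D11]

theorem JJJJ : JJ * JJ = -1 := by
  rw [sl_ext_iff]; simp [slm, sln, slo, J00, J01, J10, J11]

theorem DJ : DiagI * JJ = -(JJ * DiagI) := by
  rw [sl_ext_iff]; simp [slm, sln, D00, D01, D10, D11, J00, J01, J10, J11]

def KK : SL2C := DiagI * JJ

theorem K00 : KK.1 0 0 = 0 := by simp [KK, slm, D00, D01, D10, D11, J00, J01, J10, J11]
theorem K01 : KK.1 0 1 = Complex.I := by simp [KK, slm, D00, D01, D10, D11, J00, J01, J10, J11]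
theorem K10 : KK.1 1 0 = Complex.I := by simp [KK, slm, D00, D01, D10, D11, J00, J01, J10, J11]
theorem K11 : KK.1 1 1 = 0 := by simp [KK, slm, D00, D01, D10, D11, J00, J01, J10, J11]

theorem eq_pm_I {a : ℂ} (h : a * a = -1) : a = Complex.I ∨ a = -Complex.I := by
  have hI : Complex.I * Complex.I = -1 := Complex.I_mul_I
  have : (a - Complex.I) * (a + Complex.I) = 0 := by linear_combination h - hI
  rcases mul_eq_zero.1 this with h | h
  · left; linear_combination h
  · right; linear_combination h

theorem V0_cases {x : PSL2C} (hx : x ∈ V0) :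
    x = 1 ∨ x = projPSL DiagI ∨ x = projPSL JJ ∨ x = projPSL KK := by
  obtain ⟨M, rfl⟩ := projPSL_surj x
  rw [mem_V0_iff] at hx
  have hI0 : Complex.I ≠ 0 := Complex.I_ne_zero
  have hdet := sl_det M
  obtain ⟨h1, h2⟩ := hx
  simp only [sl_ext_iff, slm, sln, D00, D01, D10, D11, J00, J01, J10, J11] at h1 h2
  rcases h1 with ⟨-, a2, a3, -⟩ | ⟨a1, -, -, a4⟩
  · have hb : M.1 0 1 = 0 := by
      have : Complex.I * M.1 0 1 = 0 := by linear_combination (-a2) / 2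
      simpa [hI0] using this
    have hc : M.1 1 0 = 0 := by
      have : Complex.I * M.1 1 0 = 0 := by linear_combination (a3) / 2
      simpa [hI0] using this
    rw [hb, hc] at hdet
    rcases h2 with ⟨-, b2, -, -⟩ | ⟨-, b2, -, -⟩
    · left
      have hd : M.1 1 1 = M.1 0 0 := by linear_combination -b2
      rw [projPSL_eq_one]
      have : M.1 0 0 ^ 2 = 1 := by rw [hd] at hdet; linear_combination hdet
      simp at this
      simp only [sl_ext_iff, sln, slo]
      rcases this with h | h
      · left; simp [h, hd, hb, hc]
      · right; simp [h, hd, hb, hc]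
    · right; left
      have hd : M.1 1 1 = -M.1 0 0 := by linear_combination b2
      rw [projPSL_eq]
      have : M.1 0 0 * M.1 0 0 = -1 := by rw [hd] at hdet; linear_combination -hdet
      simp only [sl_ext_iff, sln, D00, D01, D10, D11]
      rcases eq_pm_I this with h | h
      · left; simp [h, hd, hb, hc]
      · right; simp [h, hd, hb, hc]
  · have ha : M.1 0 0 = 0 := by
      have : Complex.I * M.1 0 0 = 0 := by linear_combination (a1) / 2
      simpa [hI0] using this
    have hd : M.1 1 1 = 0 := by
      have : Complex.I * M.1 1 1 = 0 := by linear_combination (-a4) / 2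
      simpa [hI0] using this
    rw [ha, hd] at hdet
    rcases h2 with ⟨b1, -, -, -⟩ | ⟨b1, -, -, -⟩
    · right; right; left
      have hc : M.1 1 0 = -M.1 0 1 := by linear_combination -b1
      rw [projPSL_eq]
      have : M.1 0 1 ^ 2 = 1 := by rw [hc] at hdet; linear_combination hdet
      simp at this
      simp only [sl_ext_iff, sln, J00, J01, J10, J11]
      rcases this with h | h
      · left; simp [h, hd, ha, hc]
      · right; simp [h, hd, ha, hc]
    · right; right; right
      have hc : M.1 1 0 = M.1 0 1 := by linear_combination b1
      rw [projPSL_eq]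
      have : M.1 0 1 * M.1 0 1 = -1 := by rw [hc] at hdet; linear_combination -hdet
      simp only [sl_ext_iff, sln, K00, K01, K10, K11]
      rcases eq_pm_I this with h | h
      · left; simp [h, hd, ha, hc]
      · right; simp [h, hd, ha, hc]

theorem D_mem : projPSL DiagI ∈ V0 := by
  rw [mem_V0_iff]; exact ⟨Or.inl rfl, Or.inr DJ⟩
theorem J_mem : projPSL JJ ∈ V0 := by
  rw [mem_V0_iff]; exact ⟨Or.inr (by rw [DJ, neg_neg]), Or.inl rfl⟩
theorem K_mem : projPSL KK ∈ V0 := by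
  unfold KK; rw [map_mul]; exact V0.mul_mem D_mem J_mem

theorem D_ne : projPSL DiagI ≠ 1 := by
  rw [Ne, projPSL_eq_one]; simp [sl_ext_iff, sln, slo, D00, D01, D10, D11, Complex.ext_iff]
theorem J_ne : projPSL JJ ≠ 1 := by
  rw [Ne, projPSL_eq_one]; simp [sl_ext_iff, sln, slo, J00, J01, J10, J11]
theorem K_ne : projPSL KK ≠ 1 := by
  rw [Ne, projPSL_eq_one]; simp [sl_ext_iff, sln, slo, K00, K01, K10, K11]
theorem D_ne_J : projPSL DiagI ≠ projPSL JJ := by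
  rw [Ne, projPSL_eq]
  simp [sl_ext_iff, sln, D00, D01, D10, D11, J00, J01, J10, J11]
theorem D_ne_K : projPSL DiagI ≠ projPSL KK := by
  rw [Ne, projPSL_eq]
  simp [sl_ext_iff, sln, D00, D01, D10, D11, K00, K01, K10, K11]
theorem J_ne_K : projPSL JJ ≠ projPSL KK := by
  rw [Ne, projPSL_eq]
  simp [sl_ext_iff, sln, K00, K01, K10, K11, J00, J01, J10, J11, Complex.ext_iff]

theorem D_sq : projPSL DiagI * projPSL DiagI = 1 := by
  rw [← map_mul, DD, projPSL_eq_one]; right; rfl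
theorem J_sq : projPSL JJ * projPSL JJ = 1 := by
  rw [← map_mul, JJJJ, projPSL_eq_one]; right; rfl
theorem DJ_comm : projPSL DiagI * projPSL JJ = projPSL JJ * projPSL DiagI := by
  rw [comm_iff]; right; exact DJ
theorem K_eq : projPSL KK = projPSL DiagI * projPSL JJ := map_mul _ _ _
theorem K_sq : projPSL KK * projPSL KK = 1 := by
  rw [K_eq]; nth_rw 1 [DJ_comm]
  rw [mul_assoc, ← mul_assoc (projPSL DiagI), D_sq, one_mul, J_sq]

theorem V0_sq {x : PSL2C} (hx : x ∈ V0) : x * x = 1 := by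
  rcases V0_cases hx with rfl | rfl | rfl | rfl
  · simp
  · exact D_sq
  · exact J_sq
  · exact K_sq

theorem V0_set : (V0 : Set PSL2C) = {1, projPSL DiagI, projPSL JJ, projPSL KK} := by
  ext x
  constructor
  · intro hx
    simpa using V0_cases hx
  · rintro (rfl | rfl | rfl | rfl)
    · exact V0.one_mem
    · exact D_mem
    · exact J_mem
    · exact K_mem

theorem V0_card : Nat.card V0 = 4 := by
  classical
  change Nat.card (V0 : Set PSL2C) = 4
  rw [Nat.card_coe_set_eq, V0_set]
  have : ({1, projPSL DiagI, projPSL JJ, projPSL KK} : Set PSL2C) =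
    (({1, projPSL DiagI, projPSL JJ, projPSL KK} : Finset PSL2C) : Set PSL2C) := by simp
  rw [this, Set.ncard_coe_finset]
  rw [Finset.card_insert_of_notMem, Finset.card_insert_of_notMem, Finset.card_insert_of_notMem,
    Finset.card_singleton]
  · simpa using J_ne_K
  · simpa using ⟨D_ne_J, D_ne_K⟩
  · simpa using ⟨D_ne.symm, J_ne.symm, K_ne.symm⟩

theorem V0_klein : IsKleinFour V0 := by
  refine ⟨V0_card, ?_⟩
  have h2 : Monoid.exponent V0 ∣ 2 := by
    apply Monoid.exponent_dvd_of_forall_pow_eq_one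
    rintro ⟨x, hx⟩
    ext
    simpa [pow_two] using V0_sq hx
  rcases (Nat.dvd_prime Nat.prime_two).1 h2 with h | h
  · rw [Monoid.exp_eq_one_iff] at h
    have := V0_card
    rw [Nat.card_of_subsingleton 1] at this
    norm_num at this
  · exact h

/-! ### the transversal element -/

theorem exists_TT : ∃ (r : ℂ) (T : SL2C), r ≠ 0 ∧ T.1 = r • (DiagI.1 + JJ.1 + KK.1) := by
  obtain ⟨r, hr⟩ := IsAlgClosed.exists_pow_nat_eq (1 / 3 : ℂ) (n := 2) (by norm_num)
  have hI : Complex.I * Complex.I = -1 := Complex.I_mul_I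
  refine ⟨r, ⟨r • (DiagI.1 + JJ.1 + KK.1), ?_⟩, ?_, rfl⟩
  · rw [Matrix.det_fin_two]
    simp only [Matrix.smul_apply, Matrix.add_apply, D00, D01, D10, D11, J00, J01, J10, J11,
      K00, K01, K10, K11, smul_eq_mul]
    linear_combination 3 * hr - 2 * r ^ 2 * hI
  · rintro rfl; norm_num at hr

def rr : ℂ := exists_TT.choose
def TT : SL2C := exists_TT.choose_spec.choose
theorem rr_ne : rr ≠ 0 := exists_TT.choose_spec.choose_spec.1
theorem TT_eq : TT.1 = rr • (DiagI.1 + JJ.1 + KK.1) := exists_TT.choose_spec.choose_spec.2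

theorem TT_e : TT.1 0 0 = rr * Complex.I ∧ TT.1 0 1 = rr * (1 + Complex.I) ∧
    TT.1 1 0 = rr * (-1 + Complex.I) ∧ TT.1 1 1 = -rr * Complex.I := by
  rw [TT_eq]
  simp only [Matrix.smul_apply, Matrix.add_apply, D00, D01, D10, D11, J00, J01, J10, J11,
      K00, K01, K10, K11, smul_eq_mul]
  refine ⟨?_, ?_, ?_, ?_⟩ <;> ring

theorem V0_T {x : PSL2C} (hx : x ∈ V0) (h : x * projPSL TT = projPSL TT * x) : x = 1 := by
  obtain ⟨t1, t2, t3, t4⟩ := TT_e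
  have hr := rr_ne
  have hI : Complex.I * Complex.I = -1 := Complex.I_mul_I
  have i1 : (1 : ℂ) + Complex.I ≠ 0 := by simp [Complex.ext_iff]
  have i2 : (-1 : ℂ) + Complex.I ≠ 0 := by simp [Complex.ext_iff]
  have hI0 : Complex.I ≠ 0 := Complex.I_ne_zero
  rcases V0_cases hx with rfl | rfl | rfl | rfl
  · rfl
  all_goals
    exfalso
    rw [comm_iff] at h
    simp only [sl_ext_iff, slm, sln, D00, D01, D10, D11, J00, J01, J10, J11, K00, K01, K10, K11,
      t1, t2, t3, t4] at h
  · rcases h with ⟨-, h, -, -⟩ | ⟨h, -, -, -⟩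
    · have : rr * (Complex.I * (1 + Complex.I)) = 0 := by linear_combination h / 2
      simp [hr, hI0, i1] at this
    · have : rr = 0 := by linear_combination -h / 2 + rr * hI
      exact hr this
  · rcases h with ⟨-, h, -, -⟩ | ⟨h, -, -, -⟩
    · have : rr * Complex.I = 0 := by linear_combination -h / 2
      simp [hr, hI0] at this
    · have : rr = 0 := by linear_combination -h / 2
      exact hr this
  · rcases h with ⟨-, h, -, -⟩ | ⟨h, -, -, -⟩
    · have : rr = 0 := by linear_combination h / 2 + rr * hI
      exact hr this
    · have : rr = 0 := by linear_combination -h / 2 + rr * hI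
      exact hr this

theorem sgn {M P Q : SL2C} (h : projPSL M * projPSL P * (projPSL M)⁻¹ = projPSL Q) :
    ∃ e : ℂ, (e = 1 ∨ e = -1) ∧ M.1 * P.1 = e • (Q.1 * M.1) := by
  rw [mul_inv_eq_iff_eq_mul, ← map_mul, ← map_mul, projPSL_eq] at h
  rcases h with h | h
  · exact ⟨1, Or.inl rfl, by rw [one_smul]; exact congrArg Subtype.val h⟩
  · refine ⟨-1, Or.inr rfl, ?_⟩
    rw [neg_one_smul]; exact congrArg Subtype.val h

theorem sgn_all {M : SL2C} (hx : ∀ v ∈ V0, projPSL M * v * (projPSL M)⁻¹ ∈ V0) :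
    ∃ a b c : ℂ, (a = 1 ∨ a = -1) ∧ (b = 1 ∨ b = -1) ∧ (c = 1 ∨ c = -1) ∧
      M.1 * (DiagI.1 + JJ.1 + KK.1) = (a • DiagI.1 + b • JJ.1 + c • KK.1) * M.1 := by
  have inj : ∀ u v : PSL2C, u ≠ v → projPSL M * u * (projPSL M)⁻¹ ≠ projPSL M * v * (projPSL M)⁻¹ := by
    intro u v h h'
    apply h
    simpa using h'
  have one : ∀ u : PSL2C, u ≠ 1 → projPSL M * u * (projPSL M)⁻¹ ≠ 1 := by
    intro u h h'
    apply h
    simpa [mul_inv_eq_one] using h'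
  have hDJ := inj _ _ D_ne_J
  have hDK := inj _ _ D_ne_K
  have hJK := inj _ _ J_ne_K
  rcases V0_cases (hx _ D_mem) with h1 | h1 | h1 | h1
  · exact absurd h1 (one _ D_ne)
  all_goals
    rcases V0_cases (hx _ J_mem) with h2 | h2 | h2 | h2
    · exact absurd h2 (one _ J_ne)
    all_goals
      first
      | exact absurd (h1.trans h2.symm) hDJ
      | skip
    all_goals
      rcases V0_cases (hx _ K_mem) with h3 | h3 | h3 | h3
      · exact absurd h3 (one _ K_ne)
      all_goals
        first
        | exact absurd (h1.trans h3.symm) hDK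
        | exact absurd (h2.trans h3.symm) hJK
        | skip
      all_goals
        obtain ⟨a, ha, e1⟩ := sgn h1
        obtain ⟨b, hb, e2⟩ := sgn h2
        obtain ⟨c, hc, e3⟩ := sgn h3
        rw [mul_add, mul_add, e1, e2, e3]
        first
        | (refine ⟨a, b, c, ha, hb, hc, ?_⟩; simp only [add_mul, Matrix.smul_mul]; done)
        | (refine ⟨a, c, b, ha, hc, hb, ?_⟩; simp only [add_mul, Matrix.smul_mul]; abel; done)
        | (refine ⟨b, a, c, hb, ha, hc, ?_⟩; simp only [add_mul, Matrix.smul_mul]; abel; done)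
        | (refine ⟨b, c, a, hb, hc, ha, ?_⟩; simp only [add_mul, Matrix.smul_mul]; abel; done)
        | (refine ⟨c, a, b, hc, ha, hb, ?_⟩; simp only [add_mul, Matrix.smul_mul]; abel; done)
        | (refine ⟨c, b, a, hc, hb, ha, ?_⟩; simp only [add_mul, Matrix.smul_mul]; abel; done)

theorem sgn_fix {a b c : ℂ} (ha : a = 1 ∨ a = -1) (hb : b = 1 ∨ b = -1) (hc : c = 1 ∨ c = -1) :
    ∃ (V : SL2C) (e : ℂ), projPSL V ∈ V0 ∧ (e = 1 ∨ e = -1) ∧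
      V.1 * (a • DiagI.1 + b • JJ.1 + c • KK.1) = e • ((DiagI.1 + JJ.1 + KK.1) * V.1) := by
  have key : ∀ (V : SL2C) (e : ℂ), projPSL V ∈ V0 → (e = 1 ∨ e = -1) →
      V.1 * (a • DiagI.1 + b • JJ.1 + c • KK.1) = e • ((DiagI.1 + JJ.1 + KK.1) * V.1) → 
      ∃ (V : SL2C) (e : ℂ), projPSL V ∈ V0 ∧ (e = 1 ∨ e = -1) ∧
      V.1 * (a • DiagI.1 + b • JJ.1 + c • KK.1) = e • ((DiagI.1 + JJ.1 + KK.1) * V.1) :=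
    fun V e h1 h2 h3 => ⟨V, e, h1, h2, h3⟩
  have h1 : projPSL 1 ∈ V0 := by rw [map_one]; exact V0.one_mem
  have aux : ∀ V : SL2C, ∀ e : ℂ,
      (∀ i j, (V.1 * (a • DiagI.1 + b • JJ.1 + c • KK.1)) i j =
        (e • ((DiagI.1 + JJ.1 + KK.1) * V.1)) i j) →
      V.1 * (a • DiagI.1 + b • JJ.1 + c • KK.1) = e • ((DiagI.1 + JJ.1 + KK.1) * V.1) :=
    fun V e h => by ext i j; exact h i j
  simp only [Matrix.smul_apply, Matrix.add_apply, Matrix.mul_apply, Fin.sum_univ_two,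
    smul_eq_mul, Fin.forall_fin_two, D00, D01, D10, D11, J00, J01, J10, J11,
      K00, K01, K10, K11] at aux
  rcases ha with rfl | rfl <;> rcases hb with rfl | rfl <;> rcases hc with rfl | rfl
  · refine key 1 1 h1 (Or.inl rfl) (aux _ _ ?_)
    simp only [slo]; norm_num
  · refine key KK (-1) K_mem (Or.inr rfl) (aux _ _ ?_)
    simp only [K00, K01, K10, K11]; norm_num; try (ring_nf; simp)
  · refine key JJ (-1) J_mem (Or.inr rfl) (aux _ _ ?_)
    simp only [J00, J01, J10, J11]; norm_num; try (ring_nf; simp)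
  · refine key DiagI 1 D_mem (Or.inl rfl) (aux _ _ ?_)
    simp only [D00, D01, D10, D11]; norm_num; try (ring_nf; simp)
  · refine key DiagI (-1) D_mem (Or.inr rfl) (aux _ _ ?_)
    simp only [D00, D01, D10, D11]; norm_num; try (ring_nf; simp)
  · refine key JJ 1 J_mem (Or.inl rfl) (aux _ _ ?_)
    simp only [J00, J01, J10, J11]; norm_num; try (ring_nf; simp)
  · refine key KK 1 K_mem (Or.inl rfl) (aux _ _ ?_)
    simp only [K00, K01, K10, K11]; norm_num; try (ring_nf; simp)
  · refine key 1 (-1) h1 (Or.inr rfl) (aux _ _ ?_)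
    simp only [slo]; norm_num; try (ring_nf; simp)

theorem trans_T {x : PSL2C} (hx : ∀ v ∈ V0, x * v * x⁻¹ ∈ V0) :
    ∃ v ∈ V0, (v * x) * projPSL TT = projPSL TT * (v * x) := by
  obtain ⟨M, rfl⟩ := projPSL_surj x
  obtain ⟨a, b, c, ha, hb, hc, h⟩ := sgn_all hx
  obtain ⟨V, e, hV, he, h'⟩ := sgn_fix ha hb hc
  refine ⟨projPSL V, hV, ?_⟩
  rw [← map_mul, comm_iff]
  have : V.1 * M.1 * TT.1 = e • (TT.1 * (V.1 * M.1)) := by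
    rw [TT_eq, Matrix.mul_smul, mul_assoc, h, ← mul_assoc, h', Matrix.smul_mul, Matrix.smul_mul,
      smul_comm, mul_assoc]
  rcases he with rfl | rfl
  · left; apply Subtype.ext; rw [one_smul] at this; exact this
  · right; apply Subtype.ext; rw [neg_one_smul] at this; exact this

/-! ### embedding the normalizer into S₄ -/

abbrev N0 : Subgroup PSL2C := Subgroup.normalizer (V0 : Set PSL2C)

theorem N0_conj {x v : PSL2C} (hx : x ∈ N0) (hv : v ∈ V0) : x * v * x⁻¹ ∈ V0 :=
  (Subgroup.mem_normalizer_iff.1 hx v).1 hv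

theorem V0_le_N0 : V0 ≤ N0 := Subgroup.le_normalizer

theorem N0_embed : ∃ f : N0 →* Equiv.Perm (Fin 4), Function.Injective f := by
  let K : Subgroup N0 := (Subgroup.centralizer {projPSL TT}).subgroupOf N0
  have memK : ∀ x : N0, x ∈ K ↔ (x : PSL2C) * projPSL TT = projPSL TT * x := by
    intro x
    rw [Subgroup.mem_subgroupOf, Subgroup.mem_centralizer_iff]
    simp [eq_comm]
  have bij : Function.Bijective (fun v : V0 => ((⟨v, V0_le_N0 v.2⟩ : N0) : N0 ⧸ K)) := by
    constructor
    · intro v w h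
      rw [QuotientGroup.eq, memK] at h
      have := V0_T (V0.mul_mem (V0.inv_mem v.2) w.2) h
      ext
      exact inv_mul_eq_one.1 this
    · intro q
      obtain ⟨x, rfl⟩ := QuotientGroup.mk_surjective q
      obtain ⟨v, hv, h⟩ := trans_T (fun v hv => N0_conj x.2 hv)
      refine ⟨⟨v⁻¹, V0.inv_mem hv⟩, ?_⟩
      rw [QuotientGroup.eq, memK]
      simpa using h
  have hcard : Nat.card (N0 ⧸ K) = 4 := by
    rw [← V0_card]; exact (Nat.card_congr (Equiv.ofBijective _ bij)).symm
  have : Finite (N0 ⧸ K) := Nat.finite_of_card_ne_zero (by omega)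
  let e : (N0 ⧸ K) ≃ Fin 4 := Finite.equivFinOfCardEq hcard
  refine ⟨(e.permCongrHom.toMonoidHom).comp (MulAction.toPermHom N0 (N0 ⧸ K)), ?_⟩
  have inj : Function.Injective (MulAction.toPermHom N0 (N0 ⧸ K)) := by
    rw [← MonoidHom.ker_eq_bot_iff, ← Subgroup.normalCore_eq_ker, eq_bot_iff]
    intro n hn
    have hnor : K.normalCore.Normal := inferInstance
    have hc : ∀ v ∈ V0, (n : PSL2C) * v = v * n := by
      intro v hv
      let v' : N0 := ⟨v, V0_le_N0 hv⟩
      have h1 : n * v' * n⁻¹ * v'⁻¹ ∈ K := by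
        apply Subgroup.normalCore_le
        have := K.normalCore.mul_mem hn (hnor.conj_mem _ (K.normalCore.inv_mem hn) v')
        simpa [mul_assoc] using this
      have h2 : (n : PSL2C) * v * (n : PSL2C)⁻¹ * v⁻¹ ∈ V0 :=
        V0.mul_mem (N0_conj n.2 hv) (V0.inv_mem hv)
      have h3 := V0_T h2 ((memK _).1 h1)
      rw [mul_inv_eq_one, mul_inv_eq_iff_eq_mul] at h3
      exact h3
    have hV : (n : PSL2C) ∈ V0 := by
      unfold V0
      rw [Subgroup.mem_centralizer_iff]
      rintro y (rfl | rfl)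
      · exact (hc _ D_mem).symm
      · exact (hc _ J_mem).symm
    have := V0_T hV ((memK n).1 (Subgroup.normalCore_le _ hn))
    rw [Subgroup.mem_bot]
    exact Subtype.ext this
  exact (e.permCongrHom.injective).comp inj

/-! ### classification of subgroups between V0 and N0 -/

theorem D4_embed : ∃ f : DihedralGroup 4 →* Equiv.Perm (Fin 4), Function.Injective f := by
  let g : DihedralGroup 4 → Equiv.Perm (ZMod 4) := fun x => match x with
    | .r i => Equiv.addRight i
    | .sr i => Equiv.subLeft (-i)
  have hg : ∀ x y, g (x * y) = g x * g y := by
    rintro (i | i) (j | j)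
    · change g (.r (i + j)) = _
      ext1 x; simp [g]; abel
    · change g (.sr (j - i)) = _
      ext1 x; simp [g]; abel
    · change g (.sr (i + j)) = _
      ext1 x; simp [g]; abel
    · change g (.r (j - i)) = _
      ext1 x; simp [g]; abel
  have key : ∃ f : DihedralGroup 4 →* Equiv.Perm (ZMod 4), Function.Injective f := by
    refine ⟨MonoidHom.mk' g hg, ?_⟩
    rintro (i | i) (j | j) h
    · have := DFunLike.congr_fun h 0
      simp [g] at this; rw [this]
    · have h0 := DFunLike.congr_fun h 0
      have h1 := DFunLike.congr_fun h 1
      simp [g] at h0 h1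
      exfalso; rw [h0] at h1
      have : (2 : ZMod 4) = 0 := by linear_combination h1
      exact absurd this (by decide)
    · have h0 := DFunLike.congr_fun h 0
      have h1 := DFunLike.congr_fun h 1
      simp [g] at h0 h1
      exfalso; rw [← h0] at h1
      have : (2 : ZMod 4) = 0 := by linear_combination -h1
      exact absurd this (by decide)
    · have := DFunLike.congr_fun h 0
      simp [g] at this; rw [this]
  exact key

theorem small_class {G : Type} [Group G] (f : G →* Equiv.Perm (Fin 4)) (hf : Function.Injective f)
    (h4 : 4 ∣ Nat.card G) (hk : Nat.card G = 4 → IsKleinFour G) :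
    IsKleinFour G ∨ Nonempty (G ≃* DihedralGroup 4) ∨
    Nonempty (G ≃* alternatingGroup (Fin 4)) ∨ Nonempty (G ≃* Equiv.Perm (Fin 4)) := by
  have hS : Nat.card (Equiv.Perm (Fin 4)) = 24 := by
    rw [Nat.card_eq_fintype_card, Fintype.card_perm]; rfl
  have e : G ≃* f.range := MonoidHom.ofInjective hf
  have hc : Nat.card f.range = Nat.card G := (Nat.card_congr e.toEquiv).symm
  have hd : Nat.card G ∣ 24 := by rw [← hc, ← hS]; exact Subgroup.card_subgroup_dvd_card _
  obtain ⟨k, hk'⟩ := h4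
  have hk6 : k ∣ 6 := by
    rw [hk'] at hd; obtain ⟨m, hm⟩ := hd; exact ⟨m, by nlinarith⟩
  have : k ≤ 6 := Nat.le_of_dvd (by norm_num) hk6
  interval_cases k
  · norm_num at hk6
  · left; exact hk (by omega)
  · right; left
    obtain ⟨g, hg⟩ := D4_embed
    have e2 : DihedralGroup 4 ≃* g.range := MonoidHom.ofInjective hg
    have hc2 : Nat.card g.range = 8 := by
      rw [← Nat.card_congr e2.toEquiv, DihedralGroup.nat_card]
    have : Fact (Nat.Prime 2) := ⟨Nat.prime_two⟩
    have hfac : Nat.factorization 24 2 = 3 := by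
      have : (24 : ℕ) = 2 ^ 3 * 3 := by norm_num
      rw [this, Nat.factorization_mul (by norm_num) (by norm_num),
        Nat.Prime.factorization_pow Nat.prime_two, Nat.prime_three.factorization]
      simp
    let P : Sylow 2 (Equiv.Perm (Fin 4)) := Sylow.ofCard f.range (by rw [hc, hk', hS, hfac]; norm_num)
    let Q : Sylow 2 (Equiv.Perm (Fin 4)) := Sylow.ofCard g.range (by rw [hc2, hS, hfac]; norm_num)
    have e3 : f.range ≃* g.range := P.equiv Q
    exact ⟨e.trans (e3.trans e2.symm)⟩
  · right; right; left
    have hi : f.range.index = 2 := by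
      have := f.range.card_mul_index
      rw [hc, hk', hS] at this; omega
    have : f.range = alternatingGroup (Fin 4) := Equiv.Perm.eq_alternatingGroup_of_index_eq_two hi
    exact ⟨e.trans (MulEquiv.subgroupCongr this)⟩
  · norm_num at hk6
  · norm_num at hk6
  · right; right; right
    have : f.range = ⊤ := by
      apply Subgroup.eq_top_of_card_eq; rw [hc, hk', hS]
    exact ⟨e.trans ((MulEquiv.subgroupCongr this).trans Subgroup.topEquiv)⟩

/-! ### Klein four subgroups are conjugate -/

theorem sq_one {M : SL2C} (h : M * M = 1) : projPSL M = 1 := by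
  have hd := sl_det M
  simp only [sl_ext_iff, slm, slo] at h
  simp at h
  obtain ⟨h1, h2, h3, h4⟩ := h
  have e1 : M.1 0 0 * (M.1 0 0 + M.1 1 1) = 2 := by linear_combination h1 + hd
  have hne : M.1 0 0 + M.1 1 1 ≠ 0 := by
    intro h0; rw [h0] at e1; norm_num at e1
  have hb : M.1 0 1 = 0 := by
    apply (mul_eq_zero.1 (_ : M.1 0 1 * (M.1 0 0 + M.1 1 1) = 0)).resolve_right hne
    linear_combination h2
  have hc : M.1 1 0 = 0 := by
    apply (mul_eq_zero.1 (_ : M.1 1 0 * (M.1 0 0 + M.1 1 1) = 0)).resolve_right hne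
    linear_combination h3
  have had : M.1 1 1 = M.1 0 0 := by
    have : M.1 1 1 - M.1 0 0 = 0 := by
      apply (mul_eq_zero.1 (_ : (M.1 1 1 - M.1 0 0) * (M.1 0 0 + M.1 1 1) = 0)).resolve_right hne
      linear_combination h4 - h1
    linear_combination this
  rw [projPSL_eq_one]
  have : M.1 0 0 ^ 2 = 1 := by rw [hb] at h1; linear_combination h1
  simp at this
  simp only [sl_ext_iff, sln, slo]
  rcases this with h | h
  · left; simp [h, hb, hc, had]
  · right; simp [h, hb, hc, had]

theorem sq_neg {M : SL2C} (h : projPSL M * projPSL M = 1) (hne : projPSL M ≠ 1) : M * M = -1 := by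
  rw [← map_mul, projPSL_eq_one] at h
  exact h.resolve_left fun h => hne (sq_one h)

theorem conj_of {Z P D : SL2C} (h : Z * P = P * D) :
    projPSL Z = projPSL P * projPSL D * (projPSL P)⁻¹ := by
  rw [eq_mul_inv_iff_mul_eq, ← map_mul, ← map_mul, h]

theorem klein_conj {z w : PSL2C} (hz : z ≠ 1) (hw : w ≠ 1) (hzw : z ≠ w) (hzz : z * z = 1)
    (hww : w * w = 1) (hc : z * w = w * z) :
    ∃ P : SL2C, z = projPSL P * projPSL DiagI * (projPSL P)⁻¹ ∧
      w = projPSL P * projPSL JJ * (projPSL P)⁻¹ := by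
  obtain ⟨Z, rfl⟩ := projPSL_surj z
  obtain ⟨W, rfl⟩ := projPSL_surj w
  rcases (comm_iff _ _).1 hc with h | h
  · exfalso
    have h1 := sq_neg hzz hz
    have h2 := sq_neg hww hw
    have h3 : (Z * W) * (Z * W) = 1 := by
      calc (Z * W) * (Z * W) = Z * (W * Z) * W := by simp only [mul_assoc]
        _ = (Z * Z) * (W * W) := by rw [← h]; simp only [mul_assoc]
        _ = 1 := by rw [h1, h2]; simp
    have h4 := sq_one h3
    rw [map_mul] at h4
    apply hzw
    rw [eq_inv_of_mul_eq_one_left h4]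
    exact (eq_inv_of_mul_eq_one_left hww).symm
  · obtain ⟨P, h1, h2⟩ := conj_pair h
    exact ⟨P, conj_of h1, conj_of h2⟩

/-! ### irreducibility -/

theorem irr_anti {G : Type*} [Group G] (ρ : G →* PSL2C) (hirr : ¬ IsReducibleRep ρ) (Z : SL2C)
    (hz : projPSL Z ≠ 1) (hc : ∀ g, projPSL Z * ρ g = ρ g * projPSL Z) :
    ∃ g W, projPSL W = ρ g ∧ Z * W = -(W * Z) := by
  by_contra hcon
  push Not at hcon
  apply hirr
  obtain ⟨c, v, hv, he⟩ := exists_eigen Z.1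
  refine ⟨v, hv, fun g W hW => ?_⟩
  have hcomm : Z * W = W * Z := by
    have h := hc g
    rw [← hW] at h
    exact ((comm_iff _ _).1 h).resolve_right (hcon g W hW)
  have hu : Z.1.mulVec (W.1.mulVec v) = c • W.1.mulVec v := by
    have : Z.1 * W.1 = W.1 * Z.1 := congrArg Subtype.val hcomm
    rw [Matrix.mulVec_mulVec, this, ← Matrix.mulVec_mulVec, he, Matrix.mulVec_smul]
  generalize W.1.mulVec v = u at hu
  have f1 := congrFun he 0
  have f2 := congrFun he 1
  have g1 := congrFun hu 0
  have g2 := congrFun hu 1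
  simp only [Matrix.mulVec, dotProduct, Fin.sum_univ_two, Pi.smul_apply, smul_eq_mul] at f1 f2 g1 g2
  by_cases hdet : v 0 * u 1 - v 1 * u 0 = 0
  · by_cases h0 : v 0 = 0
    · have h1 : v 1 ≠ 0 := by
        intro h1; apply hv; ext i; fin_cases i <;> simp [h0, h1]
      refine ⟨u 1 / v 1, ?_⟩
      have hu0 : u 0 = 0 := by
        rw [h0] at hdet; simpa [h1] using hdet
      ext i; fin_cases i
      · simp [h0, hu0]
      · simp [h1]
    · refine ⟨u 0 / v 0, ?_⟩
      ext i; fin_cases i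
      · simp [h0]
      · simp; field_simp; linear_combination hdet
  · exfalso
    apply hz
    have a1 : Z.1 0 0 = c := by
      apply mul_right_cancel₀ hdet; linear_combination u 1 * f1 - v 1 * g1
    have a2 : Z.1 0 1 = 0 := by
      apply mul_right_cancel₀ hdet; linear_combination - u 0 * f1 + v 0 * g1
    have a3 : Z.1 1 0 = 0 := by
      apply mul_right_cancel₀ hdet; linear_combination u 1 * f2 - v 1 * g2
    have a4 : Z.1 1 1 = c := by
      apply mul_right_cancel₀ hdet; linear_combination - u 0 * f2 + v 0 * g2
    have hd := sl_det Z
    rw [a1, a2, a3, a4] at hd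
    have : c ^ 2 = 1 := by linear_combination hd
    simp at this
    rw [projPSL_eq_one]
    simp only [sl_ext_iff, sln, slo]
    rcases this with h | h
    · left; simp [h, a1, a2, a3, a4]
    · right; simp [h, a1, a2, a3, a4]

theorem mem_NN {x : PSL2C} (h : x * projPSL DiagI = projPSL DiagI * x) : x ∈ NNset := by
  obtain ⟨M, rfl⟩ := projPSL_surj x
  rw [comm_iff] at h
  have hI0 : Complex.I ≠ 0 := Complex.I_ne_zero
  simp only [sl_ext_iff, slm, sln, D00, D01, D10, D11] at h
  refine ⟨M, rfl, ?_⟩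
  rcases h with ⟨-, a2, a3, -⟩ | ⟨a1, -, -, a4⟩
  · left
    constructor
    · have : Complex.I * M.1 0 1 = 0 := by linear_combination (-a2) / 2
      simpa [hI0] using this
    · have : Complex.I * M.1 1 0 = 0 := by linear_combination (a3) / 2
      simpa [hI0] using this
  · right
    constructor
    · have : Complex.I * M.1 0 0 = 0 := by linear_combination (a1) / 2
      simpa [hI0] using this
    · have : Complex.I * M.1 1 1 = 0 := by linear_combination (-a4) / 2
      simpa [hI0] using this

theorem anti_ne {E M : SL2C} (h : E * M = -(M * E)) : projPSL M ≠ 1 ∧ projPSL M ≠ projPSL E := by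
  have h2 : ∀ A : SL2C, A ≠ -A := by
    intro A hA
    have hd := sl_det A
    simp only [sl_ext_iff, sln] at hA
    obtain ⟨a1, a2, a3, a4⟩ := hA
    have b1 : A.1 0 0 = 0 := by linear_combination a1 / 2
    have b2 : A.1 0 1 = 0 := by linear_combination a2 / 2
    rw [b1, b2] at hd
    norm_num at hd
  constructor
  · intro h1
    rw [projPSL_eq_one] at h1
    rcases h1 with rfl | rfl
    · apply h2 E; simpa using h
    · apply h2 E; rw [neg_mul, one_mul, neg_neg, mul_neg, mul_one] at h; exact h.symm
  · intro h1
    rw [projPSL_eq] at h1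
    rcases h1 with rfl | rfl
    · exact h2 _ h
    · apply h2 (E * E); rw [neg_mul, neg_neg, mul_neg] at h; exact h.symm

theorem V0_le_of {H : Subgroup PSL2C} (h1 : projPSL DiagI ∈ H) (h2 : projPSL JJ ∈ H) : V0 ≤ H := by
  intro x hx
  rcases V0_cases hx with rfl | rfl | rfl | rfl
  · exact H.one_mem
  · exact h1
  · exact h2
  · rw [K_eq]; exact H.mul_mem h1 h2

theorem eq_V0 {H : Subgroup PSL2C} (hle : H ≤ V0)
    (h : ∀ E : SL2C, projPSL E ∈ V0 → projPSL E ≠ 1 → 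
      ∃ M, projPSL M ∈ H ∧ E * M = -(M * E)) : H = V0 := by
  apply le_antisymm hle
  have KJ : projPSL KK * projPSL JJ = projPSL DiagI := by
    rw [K_eq, mul_assoc, J_sq, mul_one]
  have DK : projPSL DiagI * projPSL KK = projPSL JJ := by
    rw [K_eq, ← mul_assoc, D_sq, one_mul]
  obtain ⟨A, hA, hA'⟩ := h _ D_mem D_ne
  obtain ⟨B, hB, hB'⟩ := h _ J_mem J_ne
  obtain ⟨C, hC, hC'⟩ := h _ K_mem K_ne
  obtain ⟨a1, a2⟩ := anti_ne hA'
  obtain ⟨b1, b2⟩ := anti_ne hB'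
  obtain ⟨c1, c2⟩ := anti_ne hC'
  have ca : projPSL JJ ∈ H ∨ projPSL KK ∈ H := by
    rcases V0_cases (hle hA) with h | h | h | h
    · exact absurd h a1
    · exact absurd h a2
    · left; rwa [← h]
    · right; rwa [← h]
  have cb : projPSL DiagI ∈ H ∨ projPSL KK ∈ H := by
    rcases V0_cases (hle hB) with h | h | h | h
    · exact absurd h b1
    · left; rwa [← h]
    · exact absurd h b2
    · right; rwa [← h]
  have cc : projPSL DiagI ∈ H ∨ projPSL JJ ∈ H := by
    rcases V0_cases (hle hC) with h | h | h | h
    · exact absurd h c1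
    · left; rwa [← h]
    · right; rwa [← h]
    · exact absurd h c2
  have m1 : projPSL DiagI ∈ H → projPSL KK ∈ H → projPSL JJ ∈ H := fun x y => by
    rw [← DK]; exact H.mul_mem x y
  have m2 : projPSL KK ∈ H → projPSL JJ ∈ H → projPSL DiagI ∈ H := fun x y => by
    rw [← KJ]; exact H.mul_mem x y
  have : projPSL DiagI ∈ H ∧ projPSL JJ ∈ H := by tauto
  exact V0_le_of this.1 this.2

theorem klein_equiv {G H : Type*} [Group G] [Group H] (e : G ≃* H) (h : IsKleinFour H) :
    IsKleinFour G :=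
  ⟨by rw [Nat.card_congr e.toEquiv]; exact h.card_four,
    by rw [Monoid.exponent_eq_of_mulEquiv e]; exact h.exponent_two⟩

theorem N0_finite : Finite N0 := by
  obtain ⟨f, hf⟩ := N0_embed
  exact Finite.of_injective f hf

theorem class_between {R R' : Subgroup PSL2C} (e : R ≃* R') (h1 : V0 ≤ R') (h2 : R' ≤ N0) :
    IsKleinFour R ∨ Nonempty (R ≃* DihedralGroup 4) ∨
    Nonempty (R ≃* alternatingGroup (Fin 4)) ∨ Nonempty (R ≃* Equiv.Perm (Fin 4)) := by
  obtain ⟨f, hf⟩ := N0_embed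
  have hc := Nat.card_congr e.toEquiv
  have := N0_finite
  have : Finite R' := Finite.of_injective _ (Subgroup.inclusion_injective h2)
  refine small_class ((f.comp (Subgroup.inclusion h2)).comp e.toMonoidHom) ?_ ?_ ?_
  · exact (hf.comp (Subgroup.inclusion_injective h2)).comp e.injective
  · rw [hc, ← V0_card]; exact Subgroup.card_dvd_of_le h1
  · intro h4
    have : V0 = R' := Subgroup.eq_of_le_of_card_ge h1 (by rw [V0_card, ← hc, h4])
    subst this
    exact klein_equiv e V0_klein

theorem le_N0 {R : Subgroup PSL2C} (h : ∀ x ∈ R, ∀ v ∈ V0, x * v * x⁻¹ ∈ V0) : R ≤ N0 := by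
  intro x hx
  rw [Subgroup.mem_normalizer_iff]
  intro v
  refine ⟨h x hx v, fun hv => ?_⟩
  have := h x⁻¹ (R.inv_mem hx) _ hv
  simpa [mul_assoc] using this

/-! ### finiteness -/

def HasNK (G : Type*) [Group G] : Prop := ∃ a b : G, a ≠ 1 ∧ b ≠ 1 ∧ a ≠ b ∧ a * a = 1 ∧ b * b = 1 ∧
  a * b = b * a ∧ ∀ g : G, (g * a * g⁻¹ = a ∨ g * a * g⁻¹ = b ∨ g * a * g⁻¹ = a * b) ∧
    (g * b * g⁻¹ = a ∨ g * b * g⁻¹ = b ∨ g * b * g⁻¹ = a * b)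

theorem HasNK.of_equiv {G H : Type*} [Group G] [Group H] (e : G ≃* H) (h : HasNK H) : HasNK G := by
  obtain ⟨a, b, h1, h2, h3, h4, h5, h6, h7⟩ := h
  refine ⟨e.symm a, e.symm b, by simpa using h1, by simpa using h2, by simpa using h3, ?_, ?_, ?_, ?_⟩
  · rw [← map_mul, h4, map_one]
  · rw [← map_mul, h5, map_one]
  · rw [← map_mul, h6, map_mul]
  · intro g
    have key : ∀ x y : H, e g * x * (e g)⁻¹ = y → g * e.symm x * g⁻¹ = e.symm y := by
      rintro x y rfl
      simp
    obtain ⟨h8, h9⟩ := h7 (e g)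
    rw [← map_mul]
    exact ⟨h8.imp (key _ _) (Or.imp (key _ _) (key _ _)), h9.imp (key _ _) (Or.imp (key _ _) (key _ _))⟩

theorem HasNK_klein {G : Type*} [Group G] (h : IsKleinFour G) : HasNK G := by
  classical
  have hc : Nat.card G = 4 := h.card_four
  have : Finite G := Nat.finite_of_card_ne_zero (by omega)
  have := Fintype.ofFinite G
  rw [Nat.card_eq_fintype_card] at hc
  have hsq : ∀ x : G, x * x = 1 := fun x => by
    rw [← pow_two, ← h.exponent_two]; exact Monoid.pow_exponent_eq_one x
  have hcomm : ∀ x y : G, x * y = y * x := fun x y => by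
    have hinv : ∀ u : G, u⁻¹ = u := fun u => inv_eq_of_mul_eq_one_left (hsq u)
    rw [← hinv (x * y), mul_inv_rev, hinv, hinv]
  obtain ⟨a, ha⟩ : ∃ a : G, a ∉ ({1} : Finset G) := by
    by_contra hcon; push Not at hcon
    have := Finset.card_le_card (fun x _ => hcon x : (Finset.univ : Finset G) ⊆ {1})
    simp [hc] at this
  obtain ⟨b, hb⟩ : ∃ b : G, b ∉ ({1, a} : Finset G) := by
    by_contra hcon; push Not at hcon
    have := Finset.card_le_card (fun x _ => hcon x : (Finset.univ : Finset G) ⊆ {1, a})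
    have h2 := Finset.card_le_two (a := (1 : G)) (b := a)
    rw [Finset.card_univ] at this
    omega
  simp at ha hb
  refine ⟨a, b, ha, hb.1, fun h => hb.2 h.symm, hsq a, hsq b, hcomm a b, fun g => ⟨Or.inl ?_, Or.inr (Or.inl ?_)⟩⟩
  · rw [hcomm g a]; simp
  · rw [hcomm g b]; simp

theorem HasNK_D4 : HasNK (DihedralGroup 4) :=
  ⟨.r 2, .sr 0, by decide⟩

theorem HasNK_S4 : HasNK (Equiv.Perm (Fin 4)) :=
  ⟨Equiv.swap 0 1 * Equiv.swap 2 3, Equiv.swap 0 2 * Equiv.swap 1 3, by decide⟩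

theorem HasNK_A4 : HasNK (alternatingGroup (Fin 4)) :=
  ⟨⟨Equiv.swap 0 1 * Equiv.swap 2 3, by rw [Equiv.Perm.mem_alternatingGroup]; decide⟩,
    ⟨Equiv.swap 0 2 * Equiv.swap 1 3, by rw [Equiv.Perm.mem_alternatingGroup]; decide⟩,
    by decide, by decide, by decide, by decide, by decide, by decide, by
      rintro ⟨g, hg⟩
      have h : ∀ g : Equiv.Perm (Fin 4), ∀ a b : Equiv.Perm (Fin 4), 
        a = Equiv.swap 0 1 * Equiv.swap 2 3 → b = Equiv.swap 0 2 * Equiv.swap 1 3 →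
        (g * a * g⁻¹ = a ∨ g * a * g⁻¹ = b ∨ g * a * g⁻¹ = a * b) ∧
        (g * b * g⁻¹ = a ∨ g * b * g⁻¹ = b ∨ g * b * g⁻¹ = a * b) := by
        rintro g a b rfl rfl
        revert g
        decide
      simpa only [Subtype.ext_iff, Subgroup.coe_mul, Subgroup.coe_inv] using h g _ _ rfl rfl⟩

theorem HasNK_conj {Γ : Type*} [Group Γ] (ρ : Γ →* PSL2C) (h : HasNK ρ.range) :
    ∃ p : PSL2C, ∀ γ, p⁻¹ * ρ γ * p ∈ N0 := by
  obtain ⟨a, b, h1, h2, h3, h4, h5, h6, h7⟩ := h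
  obtain ⟨P, e1, e2⟩ := klein_conj (z := (a : PSL2C)) (w := (b : PSL2C)) (by simpa using h1) (by simpa using h2)
    (fun h => h3 (Subtype.ext h)) (by simpa using congrArg Subtype.val h4)
    (by simpa using congrArg Subtype.val h5) (by simpa using congrArg Subtype.val h6)
  refine ⟨projPSL P, ?_⟩
  set p := projPSL P
  have d1 : projPSL DiagI = p⁻¹ * a * p := by rw [e1]; simp [mul_assoc]
  have d2 : projPSL JJ = p⁻¹ * b * p := by rw [e2]; simp [mul_assoc]
  have m1 : p⁻¹ * a * p ∈ V0 := by rw [← d1]; exact D_mem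
  have m2 : p⁻¹ * b * p ∈ V0 := by rw [← d2]; exact J_mem
  have m3 : p⁻¹ * (a * b) * p ∈ V0 := by
    have := V0.mul_mem m1 m2
    simpa [mul_assoc] using this
  have key : ∀ γ, ∀ v ∈ V0, (p⁻¹ * ρ γ * p) * v * (p⁻¹ * ρ γ * p)⁻¹ ∈ V0 := by
    intro γ
    obtain ⟨h8, h9⟩ := h7 ⟨ρ γ, γ, rfl⟩
    simp only [Subtype.ext_iff, Subgroup.coe_mul, Subgroup.coe_inv] at h8 h9
    have aux : ∀ x : PSL2C, (p⁻¹ * ρ γ * p) * (p⁻¹ * x * p) * (p⁻¹ * ρ γ * p)⁻¹ =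
        p⁻¹ * (ρ γ * x * (ρ γ)⁻¹) * p := by intro x; group
    have g1 : (p⁻¹ * ρ γ * p) * projPSL DiagI * (p⁻¹ * ρ γ * p)⁻¹ ∈ V0 := by
      rw [d1, aux]
      rcases h8 with h | h | h <;> rw [h] <;> assumption
    have g2 : (p⁻¹ * ρ γ * p) * projPSL JJ * (p⁻¹ * ρ γ * p)⁻¹ ∈ V0 := by
      rw [d2, aux]
      rcases h9 with h | h | h <;> rw [h] <;> assumption
    have := V0_le_of (H := V0.comap (MulAut.conj (p⁻¹ * ρ γ * p)).toMonoidHom) g1 g2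
    exact fun v hv => this hv
  have hle : (ρ.range.map (MulAut.conj p⁻¹).toMonoidHom) ≤ N0 := by
    apply le_N0
    rintro _ ⟨_, ⟨γ, rfl⟩, rfl⟩ v hv
    have := key γ v hv
    simpa using this
  intro γ
  apply hle
  exact ⟨ρ γ, ⟨γ, rfl⟩, by simp⟩

theorem finite_hom {Γ G : Type*} [Group Γ] [Group G] [Finite G] (hfg : Group.FG Γ) :
    Finite (Γ →* G) := by
  obtain ⟨S, hS⟩ := hfg.out
  apply Finite.of_injective (fun f : Γ →* G => fun s : (S : Set Γ) => f s)
  intro f g h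
  apply MonoidHom.eq_of_eqOn_dense hS
  intro x hx
  exact congrFun h ⟨x, hx⟩

theorem part2 {Γ : Type*} [Group Γ] (hfg : Group.FG Γ) :
    ∃ F : Finset (Γ →* PSL2C), ∀ ρ : Γ →* PSL2C, HasSmallDihedralTypeImage ρ →
      ∃ ρ' ∈ F, ∃ B : PSL2C, ∀ γ : Γ, ρ γ = B * ρ' γ * B⁻¹ := by
  classical
  have := N0_finite
  have := finite_hom (G := N0) hfg
  have hfin : (Set.range (fun f : Γ →* N0 => N0.subtype.comp f)).Finite := Set.finite_range _
  refine ⟨hfin.toFinset, fun ρ hρ => ?_⟩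
  have hNK : HasNK ρ.range := by
    rcases hρ with h | ⟨⟨e⟩⟩ | ⟨⟨e⟩⟩ | ⟨⟨e⟩⟩
    · exact HasNK_klein h
    · exact HasNK_D4.of_equiv e
    · exact HasNK_A4.of_equiv e
    · exact HasNK_S4.of_equiv e
  obtain ⟨p, hp⟩ := HasNK_conj ρ hNK
  let f : Γ →* N0 := ((MulAut.conj p⁻¹).toMonoidHom.comp ρ).codRestrict N0 (fun γ => by
    simpa using hp γ)
  refine ⟨N0.subtype.comp f, by simp, p, fun γ => ?_⟩
  change ρ γ = p * (p⁻¹ * ρ γ * (p⁻¹)⁻¹) * p⁻¹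
  group

/-! ### main part -/

theorem part1 {Γ : Type*} [Group Γ] (Γ₀ : Subgroup Γ) [Γ₀.Normal]
    (ρ₁ ρ₂ : Γ →* PSL2C)
    (hres : ∀ γ ∈ Γ₀, ρ₁ γ = ρ₂ γ)
    (hirr : ¬ IsReducibleRep (ρ₁.comp Γ₀.subtype)) :
    (ρ₁ = ρ₂ ∨
      (∃ (B : PSL2C) (φ : Γ →* PSL2C),
        (∀ γ : Γ, φ γ = 1 ∨ φ γ = projPSL DiagI) ∧
        (∀ γ ∈ Γ₀, φ γ = 1) ∧
        (∀ γ : Γ, B * ρ₁ γ * B⁻¹ ∈ NNset) ∧ (∀ γ : Γ, B * ρ₂ γ * B⁻¹ ∈ NNset) ∧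
        (∀ γ : Γ, B * ρ₂ γ * B⁻¹ = φ γ * (B * ρ₁ γ * B⁻¹))) ∨
      (IsKleinFour ↥(Γ₀.map ρ₁) ∧ ρ₁.range = ρ₂.range ∧ HasSmallDihedralTypeImage ρ₁)) := by
  have hnor : Γ₀.Normal := inferInstance
  let C : Subgroup PSL2C := Subgroup.centralizer (Γ₀.map ρ₁ : Set PSL2C)
  have memC : ∀ x, x ∈ C ↔ ∀ g ∈ Γ₀, x * ρ₁ g = ρ₁ g * x := by
    intro x
    rw [Subgroup.mem_centralizer_iff]
    constructor
    · intro h g hg; exact (h _ ⟨g, hg, rfl⟩).symm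
    · rintro h _ ⟨g, hg, rfl⟩; exact (h g hg).symm
  have Canti : ∀ Z : SL2C, projPSL Z ∈ C → projPSL Z ≠ 1 →
      ∃ g ∈ Γ₀, ∃ W, projPSL W = ρ₁ g ∧ Z * W = -(W * Z) := by
    intro Z hZ hne
    obtain ⟨g, W, h1, h2⟩ := irr_anti _ hirr Z hne (fun g => (memC _).1 hZ g g.2)
    exact ⟨g, g.2, W, h1, h2⟩
  have Csq : ∀ z ∈ C, z * z = 1 := by
    intro z hz
    by_cases h1 : z = 1
    · simp [h1]
    obtain ⟨Z, rfl⟩ := projPSL_surj z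
    obtain ⟨g, hg, W, h2, h3⟩ := Canti Z hz h1
    rw [← map_mul, anti_sq h3, projPSL_eq_one]; right; rfl
  let c : Γ → PSL2C := fun γ => ρ₂ γ * (ρ₁ γ)⁻¹
  have hc : ∀ γ, ρ₂ γ = c γ * ρ₁ γ := fun γ => by simp [c]
  have hcC : ∀ γ, c γ ∈ C := by
    intro γ
    rw [memC]
    intro g hg
    have h1 : γ⁻¹ * g * γ ∈ Γ₀ := by simpa using hnor.conj_mem g hg γ⁻¹
    have h2 := hres _ h1
    have h3 := hres g hg
    simp only [map_mul, map_inv] at h2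
    have h4 : (ρ₁ γ)⁻¹ * ρ₁ g = (ρ₂ γ)⁻¹ * ρ₂ g * ρ₂ γ * (ρ₁ γ)⁻¹ := by rw [← h2]; group
    simp only [c]
    rw [mul_assoc, h4, h3]; group
  have hconj : ∀ γ, ∀ z ∈ C, ρ₁ γ * z * (ρ₁ γ)⁻¹ ∈ C := by
    intro γ z hz
    rw [memC]
    intro g hg
    have h1 : γ⁻¹ * g * γ ∈ Γ₀ := by simpa using hnor.conj_mem g hg γ⁻¹
    have h2 := (memC z).1 hz _ h1
    simp only [map_mul, map_inv] at h2
    calc ρ₁ γ * z * (ρ₁ γ)⁻¹ * ρ₁ g = ρ₁ γ * (z * ((ρ₁ γ)⁻¹ * ρ₁ g * ρ₁ γ)) * (ρ₁ γ)⁻¹ := by group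
      _ = ρ₁ g * (ρ₁ γ * z * (ρ₁ γ)⁻¹) := by rw [h2]; group
  by_cases heq : ρ₁ = ρ₂
  · exact Or.inl heq
  right
  obtain ⟨γ₀, hγ₀⟩ : ∃ γ, c γ ≠ 1 := by
    by_contra hcon; push Not at hcon
    apply heq; ext1 γ; rw [hc, hcon, one_mul]
  obtain ⟨z, hzC, hz1⟩ : ∃ z, z ∈ C ∧ z ≠ 1 := ⟨_, hcC γ₀, hγ₀⟩
  by_cases hall : ∀ w ∈ C, w = 1 ∨ w = z
  · left
    obtain ⟨Z, rfl⟩ := projPSL_surj z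
    obtain ⟨g, hg, W, h2, h3⟩ := Canti Z hzC hz1
    obtain ⟨P, hP, -⟩ := conj_pair h3
    have hd := conj_of hP
    set p := projPSL P
    have hcen : ∀ γ, ρ₁ γ * projPSL Z = projPSL Z * ρ₁ γ := by
      intro γ
      rcases hall _ (hconj γ _ hzC) with h | h
      · exfalso; apply hz1
        simpa [mul_inv_eq_one] using h
      · rwa [mul_inv_eq_iff_eq_mul] at h
    have hcen' : ∀ γ δ, ρ₁ γ * c δ = c δ * ρ₁ γ := by
      intro γ δ
      rcases hall _ (hcC δ) with h | h
      · simp [h]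
      · rw [h, hcen]
    have hcz : ∀ δ, c δ * projPSL Z = projPSL Z * c δ := by
      intro δ
      rcases hall _ (hcC δ) with h | h
      · simp [h]
      · rw [h]
    have hcm : ∀ γ δ, c (γ * δ) = c γ * c δ := by
      intro γ δ
      have : c (γ * δ) = c γ * (ρ₁ γ * c δ) * (ρ₁ γ)⁻¹ := by simp only [c, map_mul]; group
      rw [this, hcen']; group
    let φ₀ : Γ →* PSL2C := MonoidHom.mk' c hcm
    have hconjD : ∀ x : PSL2C, x * projPSL Z = projPSL Z * x → p⁻¹ * x * p⁻¹⁻¹ ∈ NNset := by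
      intro x hx
      apply mem_NN
      have : projPSL DiagI = p⁻¹ * projPSL Z * p := by rw [hd]; group
      rw [this]
      calc p⁻¹ * x * p⁻¹⁻¹ * (p⁻¹ * projPSL Z * p) = p⁻¹ * (x * projPSL Z) * p := by group
        _ = _ := by rw [hx]; group
    refine ⟨p⁻¹, (MulAut.conj p⁻¹).toMonoidHom.comp φ₀, ?_, ?_, ?_, ?_, ?_⟩
    · intro γ
      change p⁻¹ * c γ * p⁻¹⁻¹ = 1 ∨ p⁻¹ * c γ * p⁻¹⁻¹ = projPSL DiagI
      rcases hall _ (hcC γ) with h | h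
      · left; rw [h]; group
      · right; rw [h, hd]; group
    · intro γ hγ
      change p⁻¹ * c γ * p⁻¹⁻¹ = 1
      have : c γ = 1 := by simp [c, hres γ hγ]
      rw [this]; group
    · exact fun γ => hconjD _ (hcen γ)
    · intro γ
      apply hconjD
      rw [hc, mul_assoc, hcen, ← mul_assoc, hcz, mul_assoc]
    · intro γ
      change _ = (p⁻¹ * c γ * p⁻¹⁻¹) * _
      rw [hc]; group
  · right
    push Not at hall
    obtain ⟨w, hwC, hw1, hwz⟩ := hall
    have hcomm : z * w = w * z := by
      have hinv : ∀ u ∈ C, u⁻¹ = u := fun u hu => inv_eq_of_mul_eq_one_left (Csq u hu)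
      rw [← hinv _ (C.mul_mem hzC hwC), mul_inv_rev, hinv _ hzC, hinv _ hwC]
    obtain ⟨P, e1, e2⟩ := klein_conj hz1 hw1 (Ne.symm hwz) (Csq z hzC) (Csq w hwC) hcomm
    set p := projPSL P with hp
    let θ : PSL2C →* PSL2C := (MulAut.conj p⁻¹).toMonoidHom
    have hθ : ∀ x, θ x = p⁻¹ * x * p := fun x => by simp [θ]
    have hθinj : Function.Injective θ := (MulAut.conj p⁻¹).injective
    have d1 : projPSL DiagI = θ z := by rw [hθ, e1]; group
    have d2 : projPSL JJ = θ w := by rw [hθ, e2]; group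
    have inV : ∀ x, x * z = z * x → x * w = w * x → θ x ∈ V0 := by
      intro x h1 h2
      unfold V0
      rw [Subgroup.mem_centralizer_iff]
      rintro y (rfl | rfl)
      · rw [d1, ← map_mul, ← map_mul, h1]
      · rw [d2, ← map_mul, ← map_mul, h2]
    -- every element of V0 comes from C
    have V0C : V0 ≤ C.map θ := V0_le_of (by rw [d1]; exact ⟨z, hzC, rfl⟩) (by rw [d2]; exact ⟨w, hwC, rfl⟩)
    have hHV : (Γ₀.map ρ₁).map θ = V0 := by
      apply eq_V0
      · rintro _ ⟨_, ⟨g, hg, rfl⟩, rfl⟩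
        exact inV _ ((memC z).1 hzC g hg).symm ((memC w).1 hwC g hg).symm
      · intro E hE hE1
        obtain ⟨y, hy, hyE⟩ := V0C hE
        have hy' : projPSL (P * E * P⁻¹) = y := by
          rw [map_mul, map_mul, map_inv, ← hyE, hθ, ← hp]; group
        have hy1 : y ≠ 1 := by
          rintro rfl; apply hE1; rw [← hyE, map_one]
        obtain ⟨g, hg, W, h1, h2⟩ := Canti (P * E * P⁻¹) (by rw [hy']; exact hy) (by rw [hy']; exact hy1)
        refine ⟨P⁻¹ * W * P, ⟨ρ₁ g, ⟨g, hg, rfl⟩, ?_⟩, ?_⟩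
        · rw [hθ, map_mul, map_mul, map_inv, h1]
        · have : E * (P⁻¹ * W * P) = P⁻¹ * ((P * E * P⁻¹) * W) * P := by group
          rw [this, h2, mul_neg, neg_mul]; congr 1; group
    have hCH : C ≤ Γ₀.map ρ₁ := by
      intro x hx
      have hxz : ∀ y ∈ C, x * y = y * x := by
        intro y hy
        have hinv : ∀ u ∈ C, u⁻¹ = u := fun u hu => inv_eq_of_mul_eq_one_left (Csq u hu)
        rw [← hinv _ (C.mul_mem hx hy), mul_inv_rev, hinv _ hx, hinv _ hy]
      have h1 := inV x (hxz z hzC) (hxz w hwC)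
      rw [← hHV] at h1
      obtain ⟨y, hy, hyx⟩ := h1
      rwa [← hθinj hyx]
    have hc1 : ∀ γ, c γ ∈ ρ₁.range := by
      intro γ
      obtain ⟨g, hg, h⟩ := hCH (hcC γ)
      exact ⟨g, h⟩
    have hc2 : ∀ γ, c γ ∈ ρ₂.range := by
      intro γ
      obtain ⟨g, hg, h⟩ := hCH (hcC γ)
      exact ⟨g, by rw [← hres g hg]; exact h⟩
    refine ⟨?_, ?_, ?_⟩
    · have e := (Γ₀.map ρ₁).equivMapOfInjective θ hθinj
      exact klein_equiv (e.trans (MulEquiv.subgroupCongr hHV)) V0_klein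
    · apply le_antisymm
      · rintro _ ⟨γ, rfl⟩
        have : ρ₁ γ = (c γ)⁻¹ * ρ₂ γ := by rw [hc]; group
        rw [this]
        exact ρ₂.range.mul_mem (ρ₂.range.inv_mem (hc2 γ)) ⟨γ, rfl⟩
      · rintro _ ⟨γ, rfl⟩
        rw [hc]
        exact ρ₁.range.mul_mem (hc1 γ) ⟨γ, rfl⟩
    · refine class_between (ρ₁.range.equivMapOfInjective θ hθinj) ?_ ?_
      · rw [← hHV]
        apply Subgroup.map_mono
        rintro _ ⟨g, -, rfl⟩
        exact ⟨g, rfl⟩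
      · apply le_N0
        rintro _ ⟨_, ⟨γ, rfl⟩, rfl⟩ v hv
        rw [← hHV] at hv ⊢
        obtain ⟨_, ⟨g, hg, rfl⟩, rfl⟩ := hv
        refine ⟨ρ₁ (γ * g * γ⁻¹), ⟨_, hnor.conj_mem g hg γ, rfl⟩, ?_⟩
        simp only [map_mul, map_inv]

/-- Two homomorphisms `Γ → PSL(2,ℂ)` restricting to the same irreducible
representation of a normal subgroup `Γ₀` are either equal, or differ by a homomorphism
`Γ → Z(𝒩)` after a conjugation taking both images into `𝒩`, or the restriction has Klein
four-group image and both have equal image isomorphic to `D₂`, `D₄`, `T₁₂` or `O₂₄`; moreover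
there are only finitely many conjugacy classes of representations of the latter kind. -/
theorem stmt2 {Γ : Type*} [Group Γ] (hfg : Group.FG Γ) (Γ₀ : Subgroup Γ) [Γ₀.Normal]
    (ρ₁ ρ₂ : Γ →* PSL2C)
    (hres : ∀ γ ∈ Γ₀, ρ₁ γ = ρ₂ γ)
    (hirr : ¬ IsReducibleRep (ρ₁.comp Γ₀.subtype)) :
    (ρ₁ = ρ₂ ∨
      (∃ (B : PSL2C) (φ : Γ →* PSL2C),
        (∀ γ : Γ, φ γ = 1 ∨ φ γ = projPSL DiagI) ∧
        (∀ γ ∈ Γ₀, φ γ = 1) ∧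
        (∀ γ : Γ, B * ρ₁ γ * B⁻¹ ∈ NNset) ∧ (∀ γ : Γ, B * ρ₂ γ * B⁻¹ ∈ NNset) ∧
        (∀ γ : Γ, B * ρ₂ γ * B⁻¹ = φ γ * (B * ρ₁ γ * B⁻¹))) ∨
      (IsKleinFour ↥(Γ₀.map ρ₁) ∧ ρ₁.range = ρ₂.range ∧ HasSmallDihedralTypeImage ρ₁)) ∧
    (∃ F : Finset (Γ →* PSL2C), ∀ ρ : Γ →* PSL2C, HasSmallDihedralTypeImage ρ →
      ∃ ρ' ∈ F, ∃ B : PSL2C, ∀ γ : Γ, ρ γ = B * ρ' γ * B⁻¹) := by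
  exact ⟨part1 Γ₀ ρ₁ ρ₂ hres hirr, part2 hfg⟩
end
end

section
/- For n ∈ ℤ let Gₙ = ⟨a, b ∣ a wⁿ = wⁿ b⟩ with w = a b⁻¹ a⁻¹ b (the fundamental group of the exterior of the n-twist knot). Suppose p, q, r ≥ 2 are integers with 1/p + 1/q + 1/r = 1 (a Euclidean triple), and suppose there exists a surjective group homomorphism ρ : Gₙ → Δ(p,q,r) onto the (p,q,r)-triangle group. Then n = 1 (so the knot is the trefoil), and (p,q,r) is a permutation of (2,3,6). -/
noncomputable section

/-- The relator `a wⁿ (wⁿ b)⁻¹` with `w = a b⁻¹ a⁻¹ b`, where `a, b` are the two generators. -/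
def twistRel (n : ℤ) : FreeGroup (Fin 2) :=
  FreeGroup.of 0 *
    (FreeGroup.of 0 * (FreeGroup.of 1)⁻¹ * (FreeGroup.of 0)⁻¹ * FreeGroup.of 1) ^ n *
    ((FreeGroup.of 0 * (FreeGroup.of 1)⁻¹ * (FreeGroup.of 0)⁻¹ * FreeGroup.of 1) ^ n *
      FreeGroup.of 1)⁻¹

/-- The group `Gₙ = ⟨a, b ∣ a wⁿ = wⁿ b⟩`, `w = a b⁻¹ a⁻¹ b`; the fundamental group of the
exterior of the `n`-twist knot. -/
abbrev TwistKnotGroup (n : ℤ) := PresentedGroup ({twistRel n} : Set (FreeGroup (Fin 2)))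

/-- The relations of the triangle group `Δ(p,q,r) = ⟨x, y, z ∣ xᵖ = y^q = zʳ = xyz = 1⟩`. -/
def triangleRels3 (p q r : ℕ) : Set (FreeGroup (Fin 3)) :=
  {FreeGroup.of 0 ^ p, FreeGroup.of 1 ^ q, FreeGroup.of 2 ^ r,
    FreeGroup.of 0 * FreeGroup.of 1 * FreeGroup.of 2}

/-- The `(p,q,r)`-triangle group `Δ(p,q,r) = ⟨x, y, z ∣ xᵖ = y^q = zʳ = xyz = 1⟩`. -/
abbrev TriangleGroup (p q r : ℕ) := PresentedGroup (triangleRels3 p q r)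

/-- Affine maps `z ↦ u z + t` of the complex line. -/
@[ext] structure AffC where
  u : ℂˣ
  t : ℂ

namespace AffC

instance : Mul AffC := ⟨fun g h => ⟨g.u * h.u, g.t + g.u * h.t⟩⟩
instance : One AffC := ⟨⟨1, 0⟩⟩
instance : Inv AffC := ⟨fun g => ⟨g.u⁻¹, -((g.u⁻¹ : ℂˣ) * g.t)⟩⟩

@[simp] lemma mul_u (g h : AffC) : (g * h).u = g.u * h.u := rfl
@[simp] lemma mul_t (g h : AffC) : (g * h).t = g.t + g.u * h.t := rfl
@[simp] lemma one_u : (1 : AffC).u = 1 := rfl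
@[simp] lemma one_t : (1 : AffC).t = 0 := rfl
@[simp] lemma inv_u (g : AffC) : (g⁻¹).u = g.u⁻¹ := rfl
@[simp] lemma inv_t (g : AffC) : (g⁻¹).t = -((g.u⁻¹ : ℂˣ) * g.t) := rfl

instance : Group AffC := Group.ofLeftAxioms
  (by
    intro a b c
    ext
    · simp [mul_assoc]
    · simp; ring)
  (by intro a; ext <;> simp)
  (by intro a; ext <;> simp)

/-- The linear part. -/
def lin : AffC →* ℂˣ where
  toFun := u
  map_one' := rfl
  map_mul' _ _ := rfl

/-- The translations. -/
def trans : Multiplicative ℂ →* AffC where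
  toFun x := ⟨1, x.toAdd⟩
  map_one' := by ext <;> simp
  map_mul' _ _ := by ext <;> simp

lemma pow_u (g : AffC) (n : ℕ) : (g ^ n).u = g.u ^ n := map_pow lin g n

lemma zpow_trans (w : AffC) (hw : w.u = 1) (n : ℤ) : w ^ n = ⟨1, n * w.t⟩ := by
  have h : w = trans (Multiplicative.ofAdd w.t) := by ext <;> simp [trans, hw]
  rw [h, ← map_zpow]
  ext <;> simp [trans]

lemma pow_t (g : AffC) (n : ℕ) : (g ^ n).t * ((g.u : ℂ) - 1) = g.t * ((g.u : ℂ) ^ n - 1) := by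
  induction n with
  | zero => simp
  | succ k ih =>
    rw [pow_succ', mul_t, add_mul, mul_assoc, ih]
    ring

lemma pow_eq_one (g : AffC) (n : ℕ) (h1 : g.u ≠ 1) (hn : g.u ^ n = 1) : g ^ n = 1 := by
  have h1' : (g.u : ℂ) - 1 ≠ 0 := by
    intro h
    exact h1 (Units.ext (by simpa using sub_eq_zero.mp h))
  ext
  · simp [pow_u, hn]
  · have h := pow_t g n
    have hn' : (g.u : ℂ) ^ n = 1 := by
      rw [← Units.val_pow_eq_pow_val, hn, Units.val_one]
    rw [hn', sub_self, mul_zero] at h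
    simpa [h1'] using h

end AffC

lemma twist_rel (n : ℤ) {H : Type*} [Group H] (f : TwistKnotGroup n →* H) :
    let A := f (PresentedGroup.of 0)
    let B := f (PresentedGroup.of 1)
    A * (A * B⁻¹ * A⁻¹ * B) ^ n = (A * B⁻¹ * A⁻¹ * B) ^ n * B := by
  have h : PresentedGroup.mk ({twistRel n} : Set (FreeGroup (Fin 2))) (twistRel n) = 1 :=
    PresentedGroup.one_of_mem (Set.mem_singleton _)
  have h2 := congrArg f h
  rw [map_one] at h2
  have key : ∀ F : FreeGroup (Fin 2) →* H, F (twistRel n) = 1 →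
      F (.of 0) * (F (.of 0) * (F (.of 1))⁻¹ * (F (.of 0))⁻¹ * F (.of 1)) ^ n =
        (F (.of 0) * (F (.of 1))⁻¹ * (F (.of 0))⁻¹ * F (.of 1)) ^ n * F (.of 1) := by
    intro F hF
    simp only [twistRel, map_mul, map_inv, map_zpow] at hF
    exact mul_inv_eq_one.mp hF
  exact key (f.comp (PresentedGroup.mk _)) h2

lemma mem_zpowers_of (n : ℤ) {H : Type*} [Group H] (f : TwistKnotGroup n →* H)
    (hab : f (PresentedGroup.of 0) = f (PresentedGroup.of 1)) (g : TwistKnotGroup n) :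
    f g ∈ Subgroup.zpowers (f (PresentedGroup.of 0)) := by
  have hg : g ∈ Subgroup.closure
      (Set.range (PresentedGroup.of : Fin 2 → TwistKnotGroup n)) := by
    rw [PresentedGroup.closure_range_of]; trivial
  induction hg using Subgroup.closure_induction with
  | mem x hx =>
    obtain ⟨i, rfl⟩ := hx
    fin_cases i
    · exact Subgroup.mem_zpowers _
    · change f (PresentedGroup.of 1) ∈ _
      rw [← hab]; exact Subgroup.mem_zpowers _
  | one => simp
  | mul x y _ _ hx hy => rw [map_mul]; exact Subgroup.mul_mem _ hx hy
  | inv x _ hx => rw [map_inv]; exact Subgroup.inv_mem _ hx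

/-- Homomorphisms out of the triangle group. -/
lemma triangle_lift (p q r : ℕ) {H : Type*} [Group H] (X Y Z : H) (hX : X ^ p = 1)
    (hY : Y ^ q = 1) (hZ : Z ^ r = 1) (hXYZ : X * Y * Z = 1) :
    ∃ f : TriangleGroup p q r →* H, f (PresentedGroup.of 0) = X ∧ f (PresentedGroup.of 1) = Y ∧
      f (PresentedGroup.of 2) = Z := by
  have h : ∀ w ∈ triangleRels3 p q r, FreeGroup.lift ![X, Y, Z] w = 1 := by
    intro w hw
    simp only [triangleRels3, Set.mem_insert_iff, Set.mem_singleton_iff] at hw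
    rcases hw with rfl | rfl | rfl | rfl <;> simp [*]
  exact ⟨PresentedGroup.toGroup h, by simp [PresentedGroup.toGroup.of],
    by simp [PresentedGroup.toGroup.of], by simp [PresentedGroup.toGroup.of]⟩

/-- The abelianization obstruction. -/
lemma no_common_factor (n : ℤ) (p q r m : ℕ) (hm : 2 ≤ m) (hp : m ∣ p) (hq : m ∣ q) (hr : m ∣ r)
    (ρ : TwistKnotGroup n →* TriangleGroup p q r) (hsurj : Function.Surjective ρ) : False := by
  have hpow : ∀ (k : ℕ), m ∣ k → ∀ x : Multiplicative (ZMod m × ZMod m), x ^ k = 1 := by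
    rintro k ⟨l, rfl⟩ x
    apply Multiplicative.toAdd.injective
    ext <;> simp
  obtain ⟨f, h0, h1, -⟩ := triangle_lift p q r
    (Multiplicative.ofAdd ((1, 0) : ZMod m × ZMod m)) (Multiplicative.ofAdd (0, 1))
    (Multiplicative.ofAdd (-1, -1)) (hpow _ hp _) (hpow _ hq _) (hpow _ hr _)
    (by apply Multiplicative.toAdd.injective; ext <;> simp)
  have hrel := twist_rel n (f.comp ρ)
  have hab : (f.comp ρ) (PresentedGroup.of 0) = (f.comp ρ) (PresentedGroup.of 1) := by
    simp only at hrel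
    rw [mul_comm] at hrel
    exact mul_left_cancel hrel
  obtain ⟨x, hx⟩ := hsurj (PresentedGroup.of 0)
  obtain ⟨y, hy⟩ := hsurj (PresentedGroup.of 1)
  obtain ⟨k, hk⟩ := mem_zpowers_of n (f.comp ρ) hab x
  obtain ⟨l, hl⟩ := mem_zpowers_of n (f.comp ρ) hab y
  simp only [MonoidHom.comp_apply, hx, hy, h0, h1] at hk hl
  generalize f (ρ (PresentedGroup.of 0)) = g at hk hl
  have hk' := congrArg Multiplicative.toAdd hk
  have hl' := congrArg Multiplicative.toAdd hl
  simp only [toAdd_zpow, toAdd_ofAdd] at hk' hl'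
  have e1 := congrArg Prod.fst hk'
  have e2 := congrArg Prod.snd hk'
  have e3 := congrArg Prod.snd hl'
  simp only [Prod.smul_fst, Prod.smul_snd] at e1 e2 e3
  rw [zsmul_eq_mul] at e1 e2 e3
  have : Fact (1 < m) := ⟨hm⟩
  refine one_ne_zero (α := ZMod m) ?_
  linear_combination (-1 : ZMod m) * e3 + (l : ZMod m) * (Multiplicative.toAdd g).1 * e2 -
    (l : ZMod m) * (Multiplicative.toAdd g).2 * e1

lemma int_case (n : ℤ) (u : ℂ) (h6 : u ^ 6 = 1) (h : (n : ℂ) * ((u - 1) * (u⁻¹ - 1)) = 1) :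
    n = 1 := by
  have hu : u ≠ 0 := by rintro rfl; norm_num at h6
  have h' : (n : ℂ) * ((u - 1) * (1 - u)) = u := by
    field_simp at h
    linear_combination h
  have hf : (u - 1) * ((u + 1) * ((u ^ 2 + u + 1) * (u ^ 2 - u + 1))) = 0 := by
    linear_combination h6
  rcases mul_eq_zero.mp hf with e | hf
  · rw [e] at h; simp at h
  rcases mul_eq_zero.mp hf with e | hf
  · have : u = -1 := by linear_combination e
    subst this
    have h4 : (n : ℂ) * 4 = 1 := by linear_combination -h'
    have : n * 4 = 1 := by exact_mod_cast h4
    omega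
  rcases mul_eq_zero.mp hf with e | e
  · have h3 : ((n : ℂ) * 3 - 1) * u = 0 := by linear_combination h' + n * e
    have h3 : (n : ℂ) * 3 = 1 := by
      rcases mul_eq_zero.mp h3 with h | h
      · linear_combination h
      · exact absurd h hu
    have : n * 3 = 1 := by exact_mod_cast h3
    omega
  · have h3 : ((n : ℂ) - 1) * u = 0 := by linear_combination h' + n * e
    have h3 : (n : ℂ) = 1 := by
      rcases mul_eq_zero.mp h3 with h | h
      · linear_combination h
      · exact absurd h hu
    exact_mod_cast h3

/-- The main case: a triple of divisors of `6`. -/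
lemma main_case (n : ℤ) (p q r pp qq rr : ℕ) (hp : pp * p = 6) (hq : qq * q = 6)
    (hr : rr * r = 6) (hp1 : pp < 6) (hq1 : qq < 6) (hr1 : rr < 6) (hs : pp + qq + rr = 6)
    (ρ : TwistKnotGroup n →* TriangleGroup p q r) (hsurj : Function.Surjective ρ) : n = 1 := by
  obtain ⟨z, hz⟩ : ∃ z : ℂˣ, IsPrimitiveRoot z 6 := by
    have h := Complex.isPrimitiveRoot_exp 6 (by norm_num)
    exact ⟨_, h.isUnit_unit (by norm_num)⟩
  have hne : ∀ k : ℕ, 0 < k → k < 6 → z ^ k ≠ 1 := fun k h0 h1 =>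
    hz.pow_ne_one_of_pos_of_lt h0.ne' h1
  have hp0 : 0 < pp := by rcases Nat.eq_zero_or_pos pp with h | h <;> simp_all
  have hq0 : 0 < qq := by rcases Nat.eq_zero_or_pos qq with h | h <;> simp_all
  have hr0 : 0 < rr := by rcases Nat.eq_zero_or_pos rr with h | h <;> simp_all
  let X : AffC := ⟨z ^ pp, 0⟩
  let Y : AffC := ⟨z ^ qq, 1⟩
  have hZu : ((X * Y)⁻¹).u = z ^ rr := by
    simp only [X, Y, AffC.inv_u, AffC.mul_u]
    rw [inv_eq_iff_mul_eq_one, ← pow_add, ← pow_add, hs, hz.pow_eq_one]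
  have hX : X ^ p = 1 := AffC.pow_eq_one _ _ (hne _ hp0 hp1)
    (by simp only [X]; rw [← pow_mul, hp, hz.pow_eq_one])
  have hY : Y ^ q = 1 := AffC.pow_eq_one _ _ (hne _ hq0 hq1)
    (by simp only [Y]; rw [← pow_mul, hq, hz.pow_eq_one])
  have hZ : ((X * Y)⁻¹) ^ r = 1 := AffC.pow_eq_one _ _ (by rw [hZu]; exact hne _ hr0 hr1)
    (by rw [hZu, ← pow_mul, hr, hz.pow_eq_one])
  obtain ⟨f, h0, h1, h2⟩ := triangle_lift p q r X Y (X * Y)⁻¹ hX hY hZ (mul_inv_cancel _)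
  have hroot : ∀ g : TriangleGroup p q r, (f g).u ^ 6 = 1 := by
    intro g
    have hg : g ∈ Subgroup.closure
        (Set.range (PresentedGroup.of : Fin 3 → TriangleGroup p q r)) := by
      rw [PresentedGroup.closure_range_of]; trivial
    induction hg using Subgroup.closure_induction with
    | mem x hx =>
      obtain ⟨i, rfl⟩ := hx
      have hk : ∀ k : ℕ, (z ^ k) ^ 6 = 1 := fun k => by
        rw [← pow_mul, mul_comm, pow_mul, hz.pow_eq_one, one_pow]
      fin_cases i
      · change (f (PresentedGroup.of 0)).u ^ 6 = 1
        rw [h0]; exact hk _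
      · change (f (PresentedGroup.of 1)).u ^ 6 = 1
        rw [h1]; exact hk _
      · change (f (PresentedGroup.of 2)).u ^ 6 = 1
        rw [h2, hZu]; exact hk _
    | one => simp
    | mul x y _ _ hx hy => rw [map_mul, AffC.mul_u, mul_pow, hx, hy, one_mul]
    | inv x _ hx => rw [map_inv, AffC.inv_u, inv_pow, hx, inv_one]
  have hrel := twist_rel n (f.comp ρ)
  have hAB : (f.comp ρ) (PresentedGroup.of 0) ≠ (f.comp ρ) (PresentedGroup.of 1) := by
    intro hab
    obtain ⟨x, hx⟩ := hsurj (PresentedGroup.of 0)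
    obtain ⟨y, hy⟩ := hsurj (PresentedGroup.of 1)
    obtain ⟨k, hk⟩ := mem_zpowers_of n (f.comp ρ) hab x
    obtain ⟨l, hl⟩ := mem_zpowers_of n (f.comp ρ) hab y
    have hcomm : X * Y = Y * X := by
      simp only [MonoidHom.comp_apply, hx, hy, h0, h1] at hk hl
      rw [← hk, ← hl]
      exact (Commute.refl _).zpow_zpow k l
    have ht := congrArg AffC.t hcomm
    simp only [X, Y, AffC.mul_t] at ht
    apply hne _ hp0 hp1
    ext
    simpa using ht
  have hA6 : ((f.comp ρ) (PresentedGroup.of 0)).u ^ 6 = 1 := hroot _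
  simp only at hrel
  generalize (f.comp ρ) (PresentedGroup.of 0) = A at *
  generalize (f.comp ρ) (PresentedGroup.of 1) = B at *
  have hu : A.u = B.u := by
    have h := congrArg AffC.u hrel
    simp only [AffC.mul_u] at h
    rw [mul_comm] at h
    exact mul_left_cancel h
  have hwu : (A * B⁻¹ * A⁻¹ * B).u = 1 := by simp [hu]
  rw [AffC.zpow_trans _ hwu] at hrel
  have ht := congrArg AffC.t hrel
  simp only [AffC.mul_t, AffC.mul_u, AffC.inv_u, AffC.inv_t, ← hu] at ht
  have hd : B.t - A.t ≠ 0 := by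
    intro h
    exact hAB (AffC.ext hu (sub_eq_zero.mp h).symm)
  have hu0 : (A.u : ℂ) ≠ 0 := A.u.ne_zero
  apply int_case n (A.u : ℂ) (by rw [← Units.val_pow_eq_pow_val, hA6, Units.val_one])
  apply mul_left_cancel₀ (mul_ne_zero hd hu0)
  simp only [Units.val_mul, Units.val_inv_eq_inv_val, Units.val_one] at ht
  field_simp at ht
  linear_combination ht + (B.t - A.t) * n * ((A.u : ℂ) - 1) * mul_inv_cancel₀ hu0

lemma euc_bound (p q r : ℕ) (hq : 2 ≤ q) (hr : 2 ≤ r)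
    (h : q * r + p * r + p * q = p * q * r) : p ≤ 6 := by
  by_contra hc
  have hc : 7 ≤ p := by omega
  obtain ⟨q, rfl⟩ := Nat.exists_eq_add_of_le hq
  obtain ⟨r, rfl⟩ := Nat.exists_eq_add_of_le hr
  obtain ⟨p, rfl⟩ := Nat.exists_eq_add_of_le hc
  rcases Nat.eq_zero_or_pos q with rfl | h1
  · rcases Nat.eq_zero_or_pos r with rfl | h2
    · omega
    · nlinarith
  · rcases Nat.eq_zero_or_pos r with rfl | h2
    · nlinarith
    · nlinarith [Nat.zero_le (p * q * r), Nat.zero_le (q * r), Nat.zero_le (p * q),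
        Nat.zero_le (p * r)]

/-- If the group of the `n`-twist knot surjects onto a Euclidean triangle group
`Δ(p,q,r)` (`p, q, r ≥ 2`, `1/p + 1/q + 1/r = 1`), then `n = 1` (the trefoil) and `(p,q,r)` is a
permutation of `(2,3,6)`. -/
theorem stmt8 (n : ℤ) (p q r : ℕ) (hp : 2 ≤ p) (hq : 2 ≤ q) (hr : 2 ≤ r)
    (heuc : (1 : ℚ) / p + 1 / q + 1 / r = 1)
    (ρ : TwistKnotGroup n →* TriangleGroup p q r) (hsurj : Function.Surjective ρ) :
    n = 1 ∧ ({p, q, r} : Multiset ℕ) = ({2, 3, 6} : Multiset ℕ) := by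
  have hpqr : q * r + p * r + p * q = p * q * r := by
    have h1 : (p : ℚ) ≠ 0 := by positivity
    have h2 : (q : ℚ) ≠ 0 := by positivity
    have h3 : (r : ℚ) ≠ 0 := by positivity
    field_simp at heuc
    have : (q * r + p * r + p * q : ℚ) = p * q * r := by linear_combination heuc
    exact_mod_cast this
  have hp6 := euc_bound p q r hq hr hpqr
  have hq6 := euc_bound q p r hp hr (by linarith)
  have hr6 := euc_bound r p q hp hq (by linarith)
  clear heuc
  have hcases : (2 ∣ p ∧ 2 ∣ q ∧ 2 ∣ r) ∨ (3 ∣ p ∧ 3 ∣ q ∧ 3 ∣ r) ∨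
      (6 / p * p = 6 ∧ 6 / q * q = 6 ∧ 6 / r * r = 6 ∧ 6 / p < 6 ∧ 6 / q < 6 ∧ 6 / r < 6 ∧
        6 / p + 6 / q + 6 / r = 6 ∧ ({p, q, r} : Multiset ℕ) = ({2, 3, 6} : Multiset ℕ)) := by
    clear hsurj ρ
    interval_cases p <;> interval_cases q <;> interval_cases r <;>
      first | omega | decide
  rcases hcases with ⟨h1, h2, h3⟩ | ⟨h1, h2, h3⟩ | ⟨h1, h2, h3, h4, h5, h6, h7, h8⟩
  · exact (no_common_factor n p q r 2 le_rfl h1 h2 h3 ρ hsurj).elim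
  · exact (no_common_factor n p q r 3 (by norm_num) h1 h2 h3 ρ hsurj).elim
  · exact ⟨main_case n p q r _ _ _ h1 h2 h3 h4 h5 h6 h7 ρ hsurj, h8⟩
end
end
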